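/- arXiv:0704.3720 — 2 statements merged into one kernel-verified Lean document; each statement's English description precedes it below -/
import Mathlib

section
/- Let 0 < ρ ≤ 1, let σ : 𝒟_{d⃗} → 𝒟_{d⃗} be an injective map with σ(R) ⊆ R and |σ(R)| = ρ|R| for every R, and define (Sa)(R') = ρ^{1/2}·a(σ^{−1}(R')) for R' in the range of σ and (Sa)(R') = 0 otherwise. Then there is a constant C depending only on d⃗ such that ‖Sa‖_{CM} ≤ C·(1 + log(1/ρ))^t·‖a‖_{CM} for every a : 𝒟_{d⃗} → ℂ. Moreover, when t = 1 there is an absolute constant (depending only on d₁, independent of ρ) bounding ‖Sa‖_{CM} by a constant multiple of ‖a‖_{CM}. (Logarithmic bound for scale shifts, and uniform boundedness in one parameter.) -/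
open MeasureTheory
open scoped ENNReal

noncomputable section

/-- The model for the product space `ℝ^{d⃗}`. -/
abbrev Rd (t : ℕ) (d : Fin t → ℕ) := EuclideanSpace ℝ ((s : Fin t) × Fin (d s))

/-- A dyadic rectangle `R = Q₁ × ⋯ × Q_t ⊆ ℝ^{d⃗}`, recorded by the scale `k s` and the
position `pos s` of the dyadic cube `Q_s = 2^{k s}(pos s + [0,1)^{d_s})`. -/
structure DyadicRect (t : ℕ) (d : Fin t → ℕ) where
  k : Fin t → ℤ
  pos : (s : Fin t) → Fin (d s) → ℤ

variable {t : ℕ} {d : Fin t → ℕ}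

/-- The subset of `ℝ^{d⃗}` corresponding to a dyadic rectangle. -/
def DyadicRect.toSet (R : DyadicRect t d) : Set (Rd t d) :=
  {x | ∀ (s : Fin t) (j : Fin (d s)),
    x ⟨s, j⟩ ∈ Set.Ico ((2 : ℝ) ^ (R.k s) * (R.pos s j))
      ((2 : ℝ) ^ (R.k s) * (R.pos s j + 1))}

/-- The product Carleson norm of a coefficient function `a : 𝒟_{d⃗} → ℂ`:
`sup_U (|U|⁻¹ Σ_{R ⊆ U} |a(R)|²)^{1/2}` over open sets `U` of finite positive measure. -/
def carlesonNorm (a : DyadicRect t d → ℂ) : ℝ≥0∞ :=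
  ⨆ (U : Set (Rd t d)) (_ : IsOpen U ∧ 0 < volume U ∧ volume U < ⊤),
    ((volume U)⁻¹ *
      ∑' R : {R : DyadicRect t d // R.toSet ⊆ U}, ((‖a R.1‖₊ : ℝ≥0∞)) ^ 2) ^ (1/2 : ℝ)

section Boxes

variable {ι : Type*}

/-- The dyadic box `∏ i, 2 ^ k i * [p i, p i + 1)`. -/
def dyadicBox (k p : ι → ℤ) : Set (EuclideanSpace ℝ ι) :=
  {x | ∀ i, ⌊x i / (2 : ℝ) ^ k i⌋ = p i}

lemma floor_div_two_zpow_eq_iff (x : ℝ) (k p : ℤ) :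
    ⌊x / (2 : ℝ) ^ k⌋ = p ↔ x ∈ Set.Ico ((2 : ℝ) ^ k * p) ((2 : ℝ) ^ k * (p + 1)) := by
  have h : (0 : ℝ) < 2 ^ k := by positivity
  rw [Int.floor_eq_iff, Set.mem_Ico, le_div_iff₀' h, div_lt_iff₀' h]

lemma floor_div_two_zpow_add (x : ℝ) (k : ℤ) (n : ℕ) :
    ⌊x / (2 : ℝ) ^ (k + n)⌋ = ⌊x / (2 : ℝ) ^ k⌋ / 2 ^ n := by
  have h : x / (2 : ℝ) ^ (k + n) = (x / 2 ^ k) / ((2 ^ n : ℕ) : ℝ) := by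
    rw [zpow_add₀ two_ne_zero, zpow_natCast, div_mul_eq_div_div]
    push_cast
    rfl
  rw [h, Int.floor_div_natCast]
  push_cast
  rfl

lemma measurableSet_dyadicBox [Fintype ι] (k p : ι → ℤ) : MeasurableSet (dyadicBox k p) := by
  simp only [dyadicBox, Set.ofPred_forall]
  refine MeasurableSet.iInter fun i => ?_
  exact measurableSet_eq_fun (by fun_prop) measurable_const

lemma volume_dyadicBox [Fintype ι] (k p : ι → ℤ) :
    volume (dyadicBox k p) = ENNReal.ofReal (∏ i, (2 : ℝ) ^ k i) := by
  have h : dyadicBox k p = (WithLp.ofLp : EuclideanSpace ℝ ι → ι → ℝ) ⁻¹'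
      Set.univ.pi fun i => Set.Ico ((2 : ℝ) ^ k i * p i) ((2 : ℝ) ^ k i * (p i + 1)) := by
    ext x
    simp only [dyadicBox, Set.mem_ofPred_eq, floor_div_two_zpow_eq_iff, Set.mem_preimage,
      Set.mem_univ_pi]
  rw [h, (PiLp.volume_preserving_ofLp ι).measure_preimage
    (MeasurableSet.univ_pi fun i => measurableSet_Ico).nullMeasurableSet, Real.volume_pi_Ico,
    ENNReal.ofReal_prod_of_nonneg fun i _ => by positivity]
  exact Finset.prod_congr rfl fun i _ => by ring_nf

/-- A box whose `i`-th scale is at least `κ` cannot separate points that agree off `i`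
and share the dyadic interval of scale `κ` in direction `i`. -/
lemma mem_dyadicBox_of_floor_eq {k p : ι → ℤ} {i : ι} {κ : ℤ} (hκ : κ ≤ k i)
    {x y : EuclideanSpace ℝ ι} (hxy : ∀ j, j ≠ i → x j = y j)
    (hi : ⌊x i / (2 : ℝ) ^ κ⌋ = ⌊y i / (2 : ℝ) ^ κ⌋) (hx : x ∈ dyadicBox k p) :
    y ∈ dyadicBox k p := by
  intro j
  rw [← hx j]
  by_cases hj : j = i
  · subst hj
    obtain ⟨n, hn⟩ := Int.le.dest hκ
    rw [← hn, floor_div_two_zpow_add, floor_div_two_zpow_add, hi]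
  · rw [hxy j hj]

section Ancestors

variable [Fintype ι] {α : Type*}

/-- Doubling a box in direction `i` at most doubles its measure outside a set `B` that is
saturated for the doubled dyadic intervals in that direction. -/
lemma volume_parent_diff_le [DecidableEq ι] (k p : ι → ℤ) (i : ι) (B : Set (EuclideanSpace ℝ ι))
    (hB : ∀ x y : EuclideanSpace ℝ ι, (∀ j, j ≠ i → x j = y j) →
      ⌊x i / (2 : ℝ) ^ (k i + 1)⌋ = ⌊y i / (2 : ℝ) ^ (k i + 1)⌋ → x ∈ B → y ∈ B) :
    volume (dyadicBox (fun j => k j + ((Pi.single i 1 : ι → ℕ) j : ℤ))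
      (fun j => p j / 2 ^ (Pi.single i 1 : ι → ℕ) j) \ B) ≤ 2 * volume (dyadicBox k p \ B) := by
  set c : ℝ := if p i % 2 = 0 then 2 ^ k i else -2 ^ k i with hc
  set v : EuclideanSpace ℝ ι := EuclideanSpace.single i c with hv
  have hpos : (0 : ℝ) < 2 ^ k i := by positivity
  have hk1 : ∀ x : ℝ, ⌊x / (2 : ℝ) ^ (k i + 1)⌋ = ⌊x / (2 : ℝ) ^ k i⌋ / 2 := fun x => by
    simpa using floor_div_two_zpow_add x (k i) 1
  have hsub : dyadicBox (fun j => k j + ((Pi.single i 1 : ι → ℕ) j : ℤ))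
      (fun j => p j / 2 ^ (Pi.single i 1 : ι → ℕ) j) \ B ⊆
      (dyadicBox k p \ B) ∪ (fun x => x + -v) ⁻¹' (dyadicBox k p \ B) := by
    rintro x ⟨hx, hxB⟩
    have hxi : ⌊x i / (2 : ℝ) ^ k i⌋ / 2 = p i / 2 := by
      have := hx i
      simpa [hk1] using this
    have hxj : ∀ j, j ≠ i → ⌊x j / (2 : ℝ) ^ k j⌋ = p j := fun j hj => by
      have := hx j
      simpa [hj] using this
    by_cases hq : ⌊x i / (2 : ℝ) ^ k i⌋ = p i
    · refine Or.inl ⟨fun j => ?_, hxB⟩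
      by_cases hj : j = i
      · rw [hj, hq]
      · exact hxj j hj
    · have hyi : ⌊(x + -v) i / (2 : ℝ) ^ k i⌋ = p i := by
        have hxv : (x + -v) i = x i - c := by simp [hv, sub_eq_add_neg]
        rw [hxv, hc]
        split_ifs with h2
        · rw [sub_div, div_self hpos.ne', Int.floor_sub_one]
          omega
        · rw [sub_neg_eq_add, add_div, div_self hpos.ne', Int.floor_add_one]
          omega
      have hyj : ∀ j, j ≠ i → (x + -v) j = x j := fun j hj => by simp [hv, hj]
      refine Or.inr ⟨fun j => ?_, fun hy => hxB ?_⟩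
      · by_cases hj : j = i
        · rw [hj, hyi]
        · rw [hyj j hj, hxj j hj]
      · exact hB _ _ hyj (by rw [hk1, hk1, hyi, hxi]) hy
  calc _ ≤ _ := measure_mono hsub
    _ ≤ _ := measure_union_le _ _
    _ = 2 * volume (dyadicBox k p \ B) := by rw [measure_preimage_add_right, two_mul]

lemma volume_biUnion_parent_le [DecidableEq ι] (F : Finset α) (k p : α → ι → ℤ) (i : ι) :
    volume (⋃ a ∈ F, dyadicBox (fun j => k a j + ((Pi.single i 1 : ι → ℕ) j : ℤ))
      (fun j => p a j / 2 ^ (Pi.single i 1 : ι → ℕ) j)) ≤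
      2 * volume (⋃ a ∈ F, dyadicBox (k a) (p a)) := by
  classical
  induction F using Finset.induction_on_min_value (fun a => k a i) with
  | empty => simp
  | insert a s ha hmin ih =>
    set A := ⋃ a ∈ s, dyadicBox (k a) (p a)
    set B := ⋃ a ∈ s, dyadicBox (fun j => k a j + ((Pi.single i 1 : ι → ℕ) j : ℤ))
      (fun j => p a j / 2 ^ (Pi.single i 1 : ι → ℕ) j) with hB
    have hAm : MeasurableSet A := s.measurableSet_biUnion fun b _ => measurableSet_dyadicBox _ _
    have hAB : A ⊆ B := Set.iUnion₂_mono fun b _ => by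
      intro x hx j
      rw [floor_div_two_zpow_add, hx j]
    have hstep := volume_parent_diff_le (k a) (p a) i B fun x y hxy hi hx => by
      simp only [hB, Set.mem_iUnion] at hx ⊢
      obtain ⟨b, hb, hx⟩ := hx
      refine ⟨b, hb, mem_dyadicBox_of_floor_eq (i := i) ?_ hxy hi hx⟩
      simpa using hmin b hb
    rw [Finset.set_biUnion_insert, Finset.set_biUnion_insert, Set.union_comm, ← Set.union_sdiff_self,
      Set.union_comm (dyadicBox (k a) (p a)), ← Set.union_sdiff_self (s := A)]
    rw [measure_union' Set.disjoint_sdiff_right hAm, mul_add]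
    refine (measure_union_le _ _).trans (add_le_add ih (hstep.trans ?_))
    gcongr

lemma volume_biUnion_ancestor_le (F : Finset α) (k p : α → ι → ℤ) (m : ι → ℕ) :
    volume (⋃ a ∈ F, dyadicBox (fun j => k a j + (m j : ℤ)) (fun j => p a j / 2 ^ m j)) ≤
      2 ^ (∑ i, m i) * volume (⋃ a ∈ F, dyadicBox (k a) (p a)) := by
  classical
  induction hn : ∑ i, m i generalizing m with
  | zero =>
    have hm : ∀ i, m i = 0 := by simpa [Finset.sum_eq_zero_iff] using hn
    simp [hm]
  | succ n ih =>
    obtain ⟨i, hi⟩ : ∃ i, m i ≠ 0 := by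
      by_contra! h
      simp [h] at hn
    set m' : ι → ℕ := m - Pi.single i 1 with hm'
    have hadd : m = m' + Pi.single i 1 := by
      funext j
      by_cases hj : j = i
      · subst hj
        simp [hm']
        omega
      · simp [hm', hj]
    have hsum : ∑ j, m' j = n := by
      rw [hadd] at hn
      simpa [Finset.sum_add_distrib] using hn
    have h := volume_biUnion_parent_le F (fun a j => k a j + (m' j : ℤ))
      (fun a j => p a j / 2 ^ m' j) i
    have hpow : ∀ (q : ℤ) (u v : ℕ), q / 2 ^ u / 2 ^ v = q / 2 ^ (u + v) := fun q u v => by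
      rw [pow_add, Int.ediv_ediv_of_nonneg (pow_nonneg zero_le_two _)]
    simp only [add_assoc, ← Nat.cast_add, hpow, ← Pi.add_apply, ← hadd] at h
    rw [pow_succ', mul_assoc]
    refine h.trans ?_
    gcongr
    exact ih m' hsum

end Ancestors

section Nested

variable {k k' p p' : ι → ℤ}

/-- The lower corner of a dyadic box. -/
def boxCorner (k p : ι → ℤ) : EuclideanSpace ℝ ι := WithLp.toLp 2 fun i => (2 : ℝ) ^ k i * p i

lemma boxCorner_mem (k p : ι → ℤ) : boxCorner k p ∈ dyadicBox k p := by
  intro i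
  rw [floor_div_two_zpow_eq_iff]
  have h : (0 : ℝ) < 2 ^ k i := by positivity
  simp only [boxCorner, Set.mem_Ico, le_refl, true_and]
  nlinarith

lemma scale_le_of_dyadicBox_subset [DecidableEq ι] (h : dyadicBox k' p' ⊆ dyadicBox k p) (i : ι) :
    k' i ≤ k i := by
  by_contra! hlt
  have hpos : (0 : ℝ) < 2 ^ k i := by positivity
  have hpow : (2 : ℝ) ^ k i < 2 ^ k' i := zpow_lt_zpow_right₀ one_lt_two hlt
  have hx := h (boxCorner_mem k' p') i
  have hy := h (a := boxCorner k' p' + EuclideanSpace.single i ((2 : ℝ) ^ k i)) (fun j => by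
    by_cases hj : j = i
    · subst hj
      rw [floor_div_two_zpow_eq_iff]
      simp only [boxCorner, PiLp.add_apply, PiLp.single_apply, if_true, Set.mem_Ico]
      constructor <;> linarith
    · simpa [hj] using boxCorner_mem k' p' j) i
  rw [PiLp.add_apply, PiLp.single_apply, if_pos rfl, add_div, div_self hpos.ne',
    Int.floor_add_one, hx] at hy
  omega

lemma position_eq_of_dyadicBox_subset (h : dyadicBox k' p' ⊆ dyadicBox k p) {i : ι} {m : ℕ}
    (hm : k i = k' i + m) : p i = p' i / 2 ^ m := by
  have hx := h (boxCorner_mem k' p') i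
  rw [hm, floor_div_two_zpow_add, boxCorner_mem k' p' i] at hx
  exact hx.symm

end Nested

end Boxes

section ScaleShift

/-- The scale vector of a dyadic rectangle, one entry for each coordinate of `ℝ^{d⃗}`. -/
def DyadicRect.scale (R : DyadicRect t d) (i : (s : Fin t) × Fin (d s)) : ℤ := R.k i.1

/-- The position vector of a dyadic rectangle. -/
def DyadicRect.position (R : DyadicRect t d) (i : (s : Fin t) × Fin (d s)) : ℤ := R.pos i.1 i.2

lemma DyadicRect.toSet_eq_dyadicBox (R : DyadicRect t d) :
    R.toSet = dyadicBox R.scale R.position := by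
  ext x
  simp only [DyadicRect.toSet, dyadicBox, Set.mem_ofPred_eq, floor_div_two_zpow_eq_iff,
    DyadicRect.scale, DyadicRect.position, Sigma.forall]

/-- `R` is obtained from `R'` by enlarging its `s`-th cube by `m s` dyadic generations. -/
structure DyadicRect.IsAncestor (R R' : DyadicRect t d) (m : Fin t → ℕ) : Prop where
  scale_eq : ∀ i, R.scale i = R'.scale i + m i.1
  position_eq : ∀ i, R.position i = R'.position i / 2 ^ m i.1

lemma DyadicRect.exists_isAncestor_of_subset {R R' : DyadicRect t d}
    (h : R'.toSet ⊆ R.toSet) : ∃ m, R.IsAncestor R' m := by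
  rw [toSet_eq_dyadicBox, toSet_eq_dyadicBox] at h
  have hs : ∀ i, R.scale i = R'.scale i + ((R.k i.1 - R'.k i.1).toNat : ℕ) := fun i => by
    have := scale_le_of_dyadicBox_subset h i
    simp only [scale] at this ⊢
    omega
  exact ⟨fun s => (R.k s - R'.k s).toNat, hs, fun i => position_eq_of_dyadicBox_subset h (hs i)⟩

lemma DyadicRect.IsAncestor.volume_ratio {R R' : DyadicRect t d} {m : Fin t → ℕ}
    (h : R.IsAncestor R' m) {ρ : ℝ} (hρ : 0 < ρ)
    (hvol : volume R'.toSet = ENNReal.ofReal ρ * volume R.toSet) :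
    ρ * 2 ^ (∑ s, d s * m s) = 1 := by
  have hprod : ∏ i, (2 : ℝ) ^ R.scale i =
      (∏ i, (2 : ℝ) ^ R'.scale i) * 2 ^ (∑ s, d s * m s) := by
    simp_rw [h.scale_eq, zpow_add₀ (two_ne_zero (α := ℝ)), zpow_natCast]
    rw [Finset.prod_mul_distrib, Finset.prod_pow_eq_pow_sum, Fintype.sum_sigma]
    simp
  have hpos : (0 : ℝ) < ∏ i, (2 : ℝ) ^ R'.scale i := Finset.prod_pos fun i _ => by positivity
  rw [toSet_eq_dyadicBox, toSet_eq_dyadicBox, volume_dyadicBox, volume_dyadicBox,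
    ← ENNReal.ofReal_mul hρ.le, ENNReal.ofReal_eq_ofReal_iff hpos.le
      (mul_nonneg hρ.le (Finset.prod_nonneg fun i _ => by positivity)), hprod] at hvol
  refine mul_left_cancel₀ hpos.ne' ?_
  linear_combination -hvol

lemma volume_biUnion_toSet_le (F : Finset (DyadicRect t d)) (σ : DyadicRect t d → DyadicRect t d)
    (m : Fin t → ℕ) (h : ∀ R ∈ F, R.IsAncestor (σ R) m) :
    volume (⋃ R ∈ F, R.toSet) ≤ 2 ^ (∑ s, d s * m s) * volume (⋃ R ∈ F, (σ R).toSet) := by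
  have hle := volume_biUnion_ancestor_le F (fun R => (σ R).scale) (fun R => (σ R).position)
    fun i : (s : Fin t) × Fin (d s) => m i.1
  have hsum : ∑ i : (s : Fin t) × Fin (d s), m i.1 = ∑ s, d s * m s := by
    rw [Fintype.sum_sigma]
    simp
  rw [hsum] at hle
  have hF : ⋃ R ∈ F, R.toSet = ⋃ R ∈ F, dyadicBox (fun j => (σ R).scale j + (m j.1 : ℤ))
      (fun j => (σ R).position j / 2 ^ m j.1) := by
    refine Set.iUnion₂_congr fun R hR => ?_
    rw [DyadicRect.toSet_eq_dyadicBox, funext (h R hR).scale_eq, funext (h R hR).position_eq]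
  simpa only [hF, DyadicRect.toSet_eq_dyadicBox (σ _)] using hle

lemma tsum_le_volume_mul_carlesonNorm_sq (a : DyadicRect t d → ℂ) {U : Set (Rd t d)}
    (hU : IsOpen U) (h0 : 0 < volume U) (h1 : volume U < ⊤) :
    ∑' R : {R : DyadicRect t d // R.toSet ⊆ U}, ((‖a R.1‖₊ : ℝ≥0∞)) ^ 2 ≤
      volume U * carlesonNorm a ^ 2 := by
  have h := le_iSup₂ (f := fun (U : Set (Rd t d))
    (_ : IsOpen U ∧ 0 < volume U ∧ volume U < ⊤) => ((volume U)⁻¹ *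
      ∑' R : {R : DyadicRect t d // R.toSet ⊆ U}, ((‖a R.1‖₊ : ℝ≥0∞)) ^ 2) ^ (1/2 : ℝ))
    U ⟨hU, h0, h1⟩
  change _ ≤ carlesonNorm a at h
  have h2 := pow_le_pow_left' h 2
  rw [← ENNReal.rpow_natCast, ← ENNReal.rpow_mul] at h2
  norm_num at h2
  rwa [← ENNReal.div_eq_inv_mul, ENNReal.div_le_iff_le_mul (Or.inl h0.ne') (Or.inl h1.ne),
    mul_comm] at h2

/-- Rectangles whose shift lies in `U`, all shifted by the same number of generations, carry at
most the Carleson mass of a set of measure `3 * 2 ^ (∑ s, d s * m s) * |U|`. -/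
lemma sum_sq_le_of_isAncestor (a : DyadicRect t d → ℂ) (F : Finset (DyadicRect t d))
    (σ : DyadicRect t d → DyadicRect t d) (m : Fin t → ℕ) (h : ∀ R ∈ F, R.IsAncestor (σ R) m)
    {U : Set (Rd t d)} (hU : IsOpen U) (h0 : 0 < volume U) (h1 : volume U < ⊤)
    (hF : ∀ R ∈ F, (σ R).toSet ⊆ U) :
    ∑ R ∈ F, (‖a R‖₊ : ℝ≥0∞) ^ 2 ≤
      3 * 2 ^ (∑ s, d s * m s) * volume U * carlesonNorm a ^ 2 := by
  classical
  set V := ⋃ R ∈ F, R.toSet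
  set N := ∑ s, d s * m s
  have hVU : volume V ≤ 2 ^ N * volume U :=
    (volume_biUnion_toSet_le F σ m h).trans (by gcongr; exact Set.iUnion₂_subset hF)
  have hlt : volume V < 2 * (2 ^ N * volume U) := by
    refine hVU.trans_lt ?_
    rw [two_mul]
    exact ENNReal.lt_add_right (ENNReal.mul_lt_top (by finiteness) h1).ne
      (mul_ne_zero (by positivity) h0.ne')
  obtain ⟨O, hVO, hO, hOlt⟩ := V.exists_isOpen_lt_of_lt _ hlt
  have hvol : volume (O ∪ U) ≤ 3 * 2 ^ N * volume U := by
    calc volume (O ∪ U) ≤ volume O + volume U := measure_union_le _ _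
      _ ≤ 2 * (2 ^ N * volume U) + 2 ^ N * volume U :=
        add_le_add hOlt.le (le_mul_of_one_le_left' (one_le_pow₀ one_le_two))
      _ = 3 * 2 ^ N * volume U := by ring
  have hfin : volume (O ∪ U) < ⊤ := hvol.trans_lt (ENNReal.mul_lt_top (by finiteness) h1)
  have hsub : ∀ R ∈ F, R.toSet ⊆ O ∪ U := fun R hR =>
    ((Set.subset_biUnion_of_mem (u := fun R : DyadicRect t d => R.toSet) hR).trans hVO).trans
      Set.subset_union_left
  calc ∑ R ∈ F, (‖a R‖₊ : ℝ≥0∞) ^ 2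
      = ∑ R ∈ F.subtype (fun R => R.toSet ⊆ O ∪ U), (‖a R.1‖₊ : ℝ≥0∞) ^ 2 :=
        (Finset.sum_subtype_of_mem (fun R => (‖a R‖₊ : ℝ≥0∞) ^ 2) hsub).symm
    _ ≤ ∑' R : {R : DyadicRect t d // R.toSet ⊆ O ∪ U}, (‖a R.1‖₊ : ℝ≥0∞) ^ 2 :=
      ENNReal.sum_le_tsum _
    _ ≤ volume (O ∪ U) * carlesonNorm a ^ 2 := tsum_le_volume_mul_carlesonNorm_sq a (hO.union hU)
      (h0.trans_le (measure_mono Set.subset_union_right)) hfin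
    _ ≤ _ := by gcongr

lemma carlesonNorm_shift_le {ρ : ℝ} (hρ : 0 < ρ) (σ : DyadicRect t d → DyadicRect t d)
    (hσ : Function.Injective σ) (m : DyadicRect t d → Fin t → ℕ)
    (hm : ∀ R : DyadicRect t d, R.IsAncestor (σ R) (m R)) (hmρ : ∀ R, ρ * 2 ^ (∑ s, d s * m R s) = 1)
    (T : Finset (Fin t → ℕ)) (hT : ∀ R, m R ∈ T) (a Sa : DyadicRect t d → ℂ)
    (hSa : ∀ R, Sa (σ R) = (Real.sqrt ρ : ℂ) * a R)
    (hSa0 : ∀ R' : DyadicRect t d, R' ∉ Set.range σ → Sa R' = 0) :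
    carlesonNorm Sa ≤ (3 * T.card : ℕ) * carlesonNorm a := by
  classical
  refine iSup₂_le fun U ⟨hU, h0, h1⟩ => ?_
  set N := carlesonNorm a
  have hterm : ∀ R, (‖Sa (σ R)‖₊ : ℝ≥0∞) ^ 2 = ENNReal.ofReal ρ * (‖a R‖₊ : ℝ≥0∞) ^ 2 := fun R => by
    have hsq : (‖(Real.sqrt ρ : ℂ)‖₊ : ℝ≥0∞) ^ 2 = ENNReal.ofReal ρ := by
      rw [← enorm_eq_nnnorm, ← ofReal_norm, Complex.norm_of_nonneg (Real.sqrt_nonneg ρ),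
        ← ENNReal.ofReal_pow (Real.sqrt_nonneg ρ), Real.sq_sqrt hρ.le]
    rw [hSa, nnnorm_mul, ENNReal.coe_mul, mul_pow, hsq]
  have hfiber : ∀ F : Finset (DyadicRect t d), (∀ R ∈ F, (σ R).toSet ⊆ U) →
      ∑ R ∈ F, (‖Sa (σ R)‖₊ : ℝ≥0∞) ^ 2 ≤ (3 * T.card : ℕ) * volume U * N ^ 2 := by
    intro F hF
    rw [← Finset.sum_fiberwise_of_maps_to (t := T) (g := m) fun R _ => hT R]
    calc _ ≤ ∑ _μ ∈ T, 3 * volume U * N ^ 2 := by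
          refine Finset.sum_le_sum fun μ _ => ?_
          rcases (F.filter fun R => m R = μ).eq_empty_or_nonempty with he | ⟨R₀, hR₀⟩
          · simp [he]
          · have hμ : ρ * 2 ^ (∑ s, d s * μ s) = 1 := by
              rw [← (Finset.mem_filter.1 hR₀).2]
              exact hmρ R₀
            have hμ' : ENNReal.ofReal ρ * 2 ^ (∑ s, d s * μ s) = 1 := by
              rw [← ENNReal.ofReal_one, ← hμ, ENNReal.ofReal_mul hρ.le,
                ENNReal.ofReal_pow zero_le_two, ENNReal.ofReal_ofNat]
            simp_rw [hterm]
            rw [← Finset.mul_sum]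
            calc _ ≤ ENNReal.ofReal ρ * (3 * 2 ^ (∑ s, d s * μ s) * volume U * N ^ 2) := by
                  gcongr
                  refine sum_sq_le_of_isAncestor a _ σ μ (fun R hR => ?_) hU h0 h1 fun R hR =>
                    hF R (Finset.mem_filter.1 hR).1
                  rw [← (Finset.mem_filter.1 hR).2]
                  exact hm R
              _ = ENNReal.ofReal ρ * 2 ^ (∑ s, d s * μ s) * (3 * volume U * N ^ 2) := by ring
              _ = _ := by rw [hμ', one_mul]
      _ = _ := by
          rw [Finset.sum_const, nsmul_eq_mul]
          push_cast
          ring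
  have hsum : ∑' R : {R : DyadicRect t d // R.toSet ⊆ U}, (‖Sa R.1‖₊ : ℝ≥0∞) ^ 2 ≤
      (3 * T.card : ℕ) * volume U * N ^ 2 := by
    rw [show (∑' R : {R : DyadicRect t d // R.toSet ⊆ U}, (‖Sa R.1‖₊ : ℝ≥0∞) ^ 2) = _ from
      tsum_subtype {R : DyadicRect t d | R.toSet ⊆ U} fun R => (‖Sa R‖₊ : ℝ≥0∞) ^ 2]
    rw [← hσ.tsum_eq]
    · refine ENNReal.summable.tsum_le_of_sum_le fun F => ?_
      simp only [Set.indicator_apply, Set.mem_ofPred_eq]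
      rw [← Finset.sum_filter]
      exact hfiber _ fun R hR => (Finset.mem_filter.1 hR).2
    · intro R hR
      by_contra hn
      exact hR (by simp [Set.indicator_apply, hSa0 R hn])
  have hsq : (volume U)⁻¹ * ∑' R : {R : DyadicRect t d // R.toSet ⊆ U}, (‖Sa R.1‖₊ : ℝ≥0∞) ^ 2 ≤
      ((3 * T.card : ℕ) * N) ^ 2 := by
    rw [← ENNReal.div_eq_inv_mul, ENNReal.div_le_iff_le_mul (Or.inl h0.ne') (Or.inl h1.ne)]
    refine hsum.trans ?_
    calc _ = ((3 * T.card : ℕ) : ℝ≥0∞) * (N ^ 2 * volume U) := by ring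
      _ ≤ ((3 * T.card : ℕ) : ℝ≥0∞) ^ 2 * (N ^ 2 * volume U) := by
        gcongr
        exact_mod_cast Nat.le_self_pow two_ne_zero _
      _ = _ := by ring
  calc _ ≤ (((3 * T.card : ℕ) * N) ^ 2) ^ (1 / 2 : ℝ) := by gcongr
    _ = _ := by
      rw [← ENNReal.rpow_natCast, ← ENNReal.rpow_mul]
      norm_num

lemma exists_isAncestor_and_sum_eq {ρ : ℝ} (hρ : 0 < ρ)
    (σ : DyadicRect t d → DyadicRect t d) (hsub : ∀ R, (σ R).toSet ⊆ R.toSet)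
    (hvol : ∀ R, volume (σ R).toSet = ENNReal.ofReal ρ * volume R.toSet) :
    ∃ (n : ℕ) (m : DyadicRect t d → Fin t → ℕ), ρ * 2 ^ n = 1 ∧
      (∀ R : DyadicRect t d, R.IsAncestor (σ R) (m R)) ∧ ∀ R, ∑ s, d s * m R s = n := by
  choose m hm using fun R => DyadicRect.exists_isAncestor_of_subset (hsub R)
  have hmρ : ∀ R, ρ * 2 ^ (∑ s, d s * m R s) = 1 := fun R => (hm R).volume_ratio hρ (hvol R)
  refine ⟨_, m, hmρ ⟨0, 0⟩, hm, fun R => ?_⟩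
  exact pow_right_injective₀ two_pos (by norm_num : (2 : ℝ) ≠ 1)
    (mul_left_cancel₀ hρ.ne' ((hmρ R).trans (hmρ ⟨0, 0⟩).symm))

lemma natCast_add_one_le_of_mul_two_pow_eq_one {ρ : ℝ} {n : ℕ} (h : ρ * 2 ^ n = 1) :
    (n + 1 : ℝ) ≤ 2 * (1 + Real.log (1 / ρ)) := by
  have h2 : 1 / ρ = 2 ^ n := by
    have hρ : ρ ≠ 0 := left_ne_zero_of_mul_eq_one h
    field_simp
    linarith
  rw [h2, Real.log_pow]
  have := Real.log_two_gt_d9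
  have hn : (0 : ℝ) ≤ n := n.cast_nonneg
  nlinarith

end ScaleShift

/-- **Logarithmic bound for scale shifts** (Remark 4.6), together with the uniform
boundedness of scale shifts in the one-parameter case. -/
theorem scale_shift_carleson_log_bound (t : ℕ) (ht : 0 < t) (d : Fin t → ℕ)
    (hd : ∀ s, 0 < d s) :
    (∃ C : ℝ, 0 < C ∧
      ∀ ρ : ℝ, 0 < ρ → ρ ≤ 1 →
      ∀ σ : DyadicRect t d → DyadicRect t d, Function.Injective σ →
        (∀ R, (σ R).toSet ⊆ R.toSet) →
        (∀ R, volume (σ R).toSet = ENNReal.ofReal ρ * volume R.toSet) →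
      ∀ a Sa : DyadicRect t d → ℂ,
        (∀ R, Sa (σ R) = (Real.sqrt ρ : ℂ) * a R) →
        (∀ R' : DyadicRect t d, R' ∉ Set.range σ → Sa R' = 0) →
        carlesonNorm Sa
          ≤ ENNReal.ofReal (C * (1 + Real.log (1 / ρ)) ^ t) * carlesonNorm a) ∧
    (∀ d₁ : ℕ, 0 < d₁ →
      ∃ C' : ℝ, 0 < C' ∧
        ∀ ρ : ℝ, 0 < ρ → ρ ≤ 1 →
        ∀ σ : DyadicRect 1 (fun _ => d₁) → DyadicRect 1 (fun _ => d₁),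
          Function.Injective σ →
          (∀ R, (σ R).toSet ⊆ R.toSet) →
          (∀ R, volume (σ R).toSet = ENNReal.ofReal ρ * volume R.toSet) →
        ∀ a Sa : DyadicRect 1 (fun _ => d₁) → ℂ,
          (∀ R, Sa (σ R) = (Real.sqrt ρ : ℂ) * a R) →
          (∀ R' : DyadicRect 1 (fun _ => d₁), R' ∉ Set.range σ → Sa R' = 0) →
          carlesonNorm Sa ≤ ENNReal.ofReal C' * carlesonNorm a) := by
  refine ⟨⟨3 * 2 ^ t, by positivity, fun ρ hρ _ σ hσ hsub hvol a Sa hSa hSa0 => ?_⟩,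
    fun d₁ hd₁ => ⟨3, by norm_num, fun ρ hρ _ σ hσ hsub hvol a Sa hSa hSa0 => ?_⟩⟩
  · obtain ⟨n, m, hn, hm, hsum⟩ := exists_isAncestor_and_sum_eq hρ σ hsub hvol
    have hT : ∀ R, m R ∈ Fintype.piFinset fun _ : Fin t => Finset.range (n + 1) := fun R => by
      refine Fintype.mem_piFinset.2 fun s => Finset.mem_range_succ_iff.2 ?_
      calc m R s ≤ d s * m R s := Nat.le_mul_of_pos_left _ (hd s)
        _ ≤ ∑ s, d s * m R s :=
          Finset.single_le_sum (f := fun s => d s * m R s) (fun _ _ => Nat.zero_le _)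
            (Finset.mem_univ s)
        _ = n := hsum R
    refine (carlesonNorm_shift_le hρ σ hσ m hm (fun R => by rw [hsum R, hn]) _ hT a Sa hSa
      hSa0).trans ?_
    gcongr
    rw [← ENNReal.ofReal_natCast]
    refine ENNReal.ofReal_le_ofReal ?_
    rw [Fintype.card_piFinset_const, Finset.card_range, mul_assoc, ← mul_pow]
    push_cast
    gcongr
    exact natCast_add_one_le_of_mul_two_pow_eq_one hn
  · obtain ⟨n, m, hn, hm, hsum⟩ := exists_isAncestor_and_sum_eq hρ σ hsub hvol
    have hT : ∀ R, m R ∈ ({fun _ => n / d₁} : Finset (Fin 1 → ℕ)) := fun R => by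
      rw [Finset.mem_singleton]
      funext s
      rw [← hsum R, Fin.sum_univ_one, Nat.mul_div_cancel_left _ hd₁, Subsingleton.elim s 0]
    simpa using carlesonNorm_shift_le hρ σ hσ m hm (fun R => by rw [hsum R, hn]) _ hT a Sa hSa hSa0
end
end

section
/- Let t ≥ 2. There is a constant C depending only on d⃗ such that for every η > 0 there is a constant K_η (depending only on η and d⃗) with the following property: for every collection 𝒰 ⊆ 𝒟_{d⃗} whose shadow sh(𝒰) = ⋃_{R∈𝒰} R has finite Lebesgue measure, there exist a measurable set V ⊇ sh(𝒰) and a function Emb : 𝒰 → [1,∞) such that (i) Emb(R)·R ⊆ V for every R ∈ 𝒰; (ii) |V| ≤ (1+η)·|sh(𝒰)|; and (iii) for every a : 𝒟_{d⃗} → ℂ, the coefficient function equal to Emb(R)^{−C}·a(R) for R ∈ 𝒰 and to 0 for R ∉ 𝒰 satisfies ‖Emb^{−C}·a·1_𝒰‖_{CM} ≤ K_η·‖a‖_{CM,−1}. (Coefficient form of Journé's Lemma with the refinement |V| < (1+η)|sh(𝒰)|.) -/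
open MeasureTheory
open scoped ENNReal

noncomputable section

variable {t : ℕ} {d : Fin t → ℕ}

/-- The rectangle with the same center as `R` and all side lengths multiplied by
`lam`: the dilate `lam·R`. -/
def DyadicRect.dilate (R : DyadicRect t d) (lam : ℝ) : Set (Rd t d) :=
  {x | ∀ (s : Fin t) (j : Fin (d s)),
    |x ⟨s, j⟩ - (2 : ℝ) ^ (R.k s) * (R.pos s j + 1/2)| ≤ lam * (2 : ℝ) ^ (R.k s) / 2}

/-- The shadow `⋃_{R ∈ 𝒰} R` of a collection of dyadic rectangles. -/
def shadow (𝒰 : Set (DyadicRect t d)) : Set (Rd t d) :=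
  ⋃ R ∈ 𝒰, R.toSet

/-- A collection of dyadic rectangles has `t−1` parameters: in some coordinate `s` all
its rectangles have one and the same dyadic cube. -/
def HasParamsSub (𝒰 : Set (DyadicRect t d)) : Prop :=
  ∃ (s : Fin t) (k : ℤ) (q : Fin (d s) → ℤ), ∀ R ∈ 𝒰, R.k s = k ∧ R.pos s = q

/-- The `BMO_{−1}` norm of a coefficient function: the supremum of
`(|sh(𝒰)|⁻¹ Σ_{R∈𝒰} |a(R)|²)^{1/2}` over collections `𝒰` with `t−1` parameters. -/
def carlesonNormM1 (a : DyadicRect t d → ℂ) : ℝ≥0∞ :=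
  ⨆ (𝒰 : Set (DyadicRect t d)) (_ : HasParamsSub 𝒰),
    ((volume (shadow 𝒰))⁻¹ * ∑' R : 𝒰, ((‖a R.1‖₊ : ℝ≥0∞)) ^ 2) ^ (1/2 : ℝ)

open Classical

/-- The index of the dyadic cube of generation `k` containing `y`. -/
def dyadicIndex {n : ℕ} (k : ℤ) (y : Fin n → ℝ) : Fin n → ℤ := fun i => ⌊y i / 2 ^ k⌋

/-- The dyadic cube `2^k (q + [0,1)^n)`, for `Q = (k, q)`. -/
def dyadicCube {n : ℕ} (Q : ℤ × (Fin n → ℤ)) : Set (Fin n → ℝ) :=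
  {y | dyadicIndex Q.1 y = Q.2}

/-- The center of the dyadic cube `2^k (q + [0,1)^n)`. -/
def dyadicCenter {n : ℕ} (Q : ℤ × (Fin n → ℤ)) : Fin n → ℝ :=
  fun i => 2 ^ Q.1 * (Q.2 i + 1 / 2)

theorem mem_dyadicCube {n : ℕ} {Q : ℤ × (Fin n → ℤ)} {y : Fin n → ℝ} :
    y ∈ dyadicCube Q ↔
      ∀ i, y i ∈ Set.Ico ((2 : ℝ) ^ Q.1 * Q.2 i) (2 ^ Q.1 * (Q.2 i + 1)) := by
  have h2 : (0 : ℝ) < 2 ^ Q.1 := by positivity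
  simp only [dyadicCube, Set.mem_ofPred_eq, funext_iff, dyadicIndex, Int.floor_eq_iff,
    Set.mem_Ico, le_div_iff₀' h2, div_lt_iff₀' h2]

theorem mem_dyadicCube_dyadicIndex {n : ℕ} (k : ℤ) (y : Fin n → ℝ) :
    y ∈ dyadicCube (k, dyadicIndex k y) := rfl

theorem dyadicCube_eq_pi {n : ℕ} (Q : ℤ × (Fin n → ℤ)) :
    dyadicCube Q = Set.pi Set.univ
      (fun i => Set.Ico ((2 : ℝ) ^ Q.1 * Q.2 i) (2 ^ Q.1 * (Q.2 i + 1))) := by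
  ext y
  simp [mem_dyadicCube]

theorem measurable_dyadicIndex {n : ℕ} (k : ℤ) :
    Measurable (dyadicIndex k : (Fin n → ℝ) → Fin n → ℤ) :=
  measurable_pi_lambda _ fun i => Int.measurable_floor.comp ((measurable_pi_apply i).div_const _)

theorem measurableSet_dyadicCube {n : ℕ} (Q : ℤ × (Fin n → ℤ)) :
    MeasurableSet (dyadicCube Q) :=
  measurable_dyadicIndex Q.1 (measurableSet_singleton Q.2)

theorem volume_dyadicCube {n : ℕ} (Q : ℤ × (Fin n → ℤ)) :
    volume (dyadicCube Q) = ENNReal.ofReal ((2 ^ Q.1) ^ n) := by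
  rw [dyadicCube_eq_pi, Real.volume_pi_Ico, ENNReal.ofReal_pow (by positivity)]
  simp [mul_add]

theorem volume_closedBall_two_zpow {n : ℕ} (x : Fin n → ℝ) (j : ℤ) :
    volume (Metric.closedBall x ((2 : ℝ) ^ j)) = ENNReal.ofReal ((2 ^ (j + 1)) ^ n) := by
  rw [Real.volume_pi_closedBall _ (by positivity), Fintype.card_fin, zpow_add_one₀ two_ne_zero,
    mul_comm]

theorem dyadicIndex_eq_of_le {n : ℕ} {k k' : ℤ} (h : k ≤ k') {x y : Fin n → ℝ}
    (hxy : dyadicIndex k x = dyadicIndex k y) : dyadicIndex k' x = dyadicIndex k' y := by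
  obtain ⟨m, rfl⟩ := Int.le.dest h
  have key : ∀ z : ℝ, ⌊z / (2 : ℝ) ^ (k + (m : ℤ))⌋ = ⌊z / 2 ^ k⌋ / ((2 ^ m : ℕ) : ℤ) := by
    intro z
    rw [← Int.floor_div_natCast, div_div, zpow_add₀ two_ne_zero]
    simp
  funext i
  have := congrFun hxy i
  simp only [dyadicIndex] at this ⊢
  rw [key, key, this]

theorem dyadicCube_subset {n : ℕ} {Q Q' : ℤ × (Fin n → ℤ)} (h : Q.1 ≤ Q'.1) {y : Fin n → ℝ}
    (hy : y ∈ dyadicCube Q) (hy' : y ∈ dyadicCube Q') : dyadicCube Q ⊆ dyadicCube Q' := by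
  intro z hz
  have : dyadicIndex Q.1 z = dyadicIndex Q.1 y := hz.trans hy.symm
  exact (dyadicIndex_eq_of_le h this).trans hy'

theorem dyadicCube_subset_closedBall {n : ℕ} (Q : ℤ × (Fin n → ℤ)) :
    dyadicCube Q ⊆ Metric.closedBall (dyadicCenter Q) (2 ^ (Q.1 - 1)) := by
  intro y hy
  rw [mem_dyadicCube] at hy
  rw [Metric.mem_closedBall, dist_pi_le_iff (by positivity)]
  intro i
  have := hy i
  rw [Real.dist_eq, abs_le, zpow_sub_one₀ two_ne_zero, dyadicCenter]
  constructor <;> nlinarith [this.1, this.2]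

/-- Among dyadic cubes with bounded side lengths, each one lies in a maximal one, and distinct
maximal ones are disjoint. -/
theorem exists_maximal_dyadicCube {n : ℕ} (T : Set (ℤ × (Fin n → ℤ))) (B : ℤ)
    (hB : ∀ Q ∈ T, Q.1 ≤ B) :
    ∃ top : ℤ × (Fin n → ℤ) → ℤ × (Fin n → ℤ),
      (∀ Q ∈ T, top Q ∈ T ∧ Q.1 ≤ (top Q).1 ∧ dyadicCube Q ⊆ dyadicCube (top Q)) ∧
      ∀ Q ∈ T, ∀ Q' ∈ T, ∀ y, y ∈ dyadicCube (top Q) → y ∈ dyadicCube (top Q') →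
        top Q = top Q' := by
  have h : ∀ Q : ℤ × (Fin n → ℤ), ∃ P : ℤ × (Fin n → ℤ), Q ∈ T →
      (P ∈ T ∧ Q.1 ≤ P.1 ∧ dyadicCube Q ⊆ dyadicCube P) ∧
      ∀ P' ∈ T, Q.1 ≤ P'.1 → dyadicCube Q ⊆ dyadicCube P' → P'.1 ≤ P.1 := by
    intro Q
    by_cases hQ : Q ∈ T
    · obtain ⟨k, ⟨q, hq⟩, hk⟩ := Int.exists_greatest_of_bdd
        (P := fun k => ∃ q, (k, q) ∈ T ∧ Q.1 ≤ k ∧ dyadicCube Q ⊆ dyadicCube (k, q))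
        ⟨B, fun k ⟨q, hq, _⟩ => hB _ hq⟩ ⟨Q.1, Q.2, hQ, le_rfl, subset_rfl⟩
      exact ⟨(k, q), fun _ => ⟨hq, fun P' hP' h1 h2 => hk P'.1 ⟨P'.2, hP', h1, h2⟩⟩⟩
    · exact ⟨Q, fun h => absurd h hQ⟩
  choose top htop using h
  have aux : ∀ Q ∈ T, ∀ Q' ∈ T, ∀ y, y ∈ dyadicCube (top Q) → y ∈ dyadicCube (top Q') →
      (top Q).1 ≤ (top Q').1 → top Q = top Q' := by
    intro Q hQ Q' hQ' y hy hy' hle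
    have hsub := dyadicCube_subset hle hy hy'
    have h1 := (htop Q hQ).2 _ (htop Q' hQ').1.1 ((htop Q hQ).1.2.1.trans hle)
      ((htop Q hQ).1.2.2.trans hsub)
    have heq : (top Q).1 = (top Q').1 := le_antisymm hle h1
    refine Prod.ext heq ?_
    rw [← (show dyadicIndex _ y = _ from hy), ← (show dyadicIndex _ y = _ from hy'), heq]
  refine ⟨top, fun Q hQ => (htop Q hQ).1, fun Q hQ Q' hQ' y hy hy' => ?_⟩
  rcases le_total (top Q).1 (top Q').1 with hle | hle
  · exact aux Q hQ Q' hQ' y hy hy' hle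
  · exact (aux Q' hQ' Q hQ y hy' hy hle).symm

theorem exists_scale_bound {n : ℕ} (hn : 0 < n) {v : ℝ≥0∞} (hv : v ≠ ⊤) :
    ∃ B : ℤ, ∀ k : ℤ, ENNReal.ofReal ((2 ^ k) ^ n) ≤ v → k ≤ B := by
  obtain ⟨B, hB⟩ := pow_unbounded_of_one_lt v.toReal (one_lt_two : (1 : ℝ) < 2)
  refine ⟨B, fun k hk => ?_⟩
  by_contra! hlt
  rw [ENNReal.ofReal_le_iff_le_toReal hv] at hk
  have h1 : (2 : ℝ) ^ B ≤ 2 ^ k := by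
    rw [← zpow_natCast]
    exact zpow_le_zpow_right₀ one_le_two hlt.le
  have h2 : (1 : ℝ) ≤ 2 ^ k := (one_le_pow₀ one_le_two).trans h1
  have h3 : (2 : ℝ) ^ k ≤ (2 ^ k) ^ n := le_self_pow₀ h2 hn.ne'
  linarith

theorem measure_diff_le_of_density {Y : Type*} [MeasurableSpace Y] {μ : Measure Y} {l : ℝ}
    (hl : 0 < l) {B E : Set Y} (hE : MeasurableSet E) (hB : μ B ≠ ⊤)
    (h : ENNReal.ofReal l * μ B ≤ μ (B ∩ E)) :
    μ (B \ E) ≤ ENNReal.ofReal ((1 - l) / l) * μ (B ∩ E) := by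
  have hsum := measure_inter_add_sdiff (μ := μ) B hE
  have hq : μ (B ∩ E) ≠ ⊤ := ne_top_of_le_ne_top hB (measure_mono Set.inter_subset_left)
  have hp : μ (B \ E) ≠ ⊤ := ne_top_of_le_ne_top hB (measure_mono Set.sdiff_subset)
  rw [← hsum, ← ENNReal.ofReal_toReal hq, ← ENNReal.ofReal_toReal hp,
    ← ENNReal.ofReal_add ENNReal.toReal_nonneg ENNReal.toReal_nonneg,
    ← ENNReal.ofReal_mul hl.le, ENNReal.ofReal_le_ofReal_iff ENNReal.toReal_nonneg] at h
  rw [← ENNReal.ofReal_toReal hq, ← ENNReal.ofReal_toReal hp,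
    ← ENNReal.ofReal_mul' ENNReal.toReal_nonneg]
  apply ENNReal.ofReal_le_ofReal
  rw [div_mul_eq_mul_div, le_div_iff₀ hl]
  linarith

/-- If `A` is covered by `N` disjoint families of sets in each of which `E` has density at
least `l`, then adding `A` to `E` increases its measure by a factor at most
`1 + N (1 - l) / l`. -/
theorem measure_union_le_of_covering {Y ι : Type*} [MeasurableSpace Y] {μ : Measure Y} {l : ℝ}
    (hl : 0 < l) (hl1 : l < 1) {N : ℕ} {E A : Set Y} (hE : MeasurableSet E) (s : Fin N → Set ι)
    (hs : ∀ i, (s i).Countable) (B : ι → Set Y) (hBm : ∀ j, MeasurableSet (B j))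
    (hBf : ∀ j, μ (B j) ≠ ⊤) (hdisj : ∀ i, (s i).PairwiseDisjoint B)
    (hA : A ⊆ ⋃ i, ⋃ j ∈ s i, B j)
    (hdens : ∀ i, ∀ j ∈ s i, ENNReal.ofReal l * μ (B j) ≤ μ (B j ∩ E)) :
    μ (E ∪ A) ≤ ENNReal.ofReal (1 + N * ((1 - l) / l)) * μ E := by
  have hc : 0 ≤ (1 - l) / l := div_nonneg (by linarith) hl.le
  have hfam : ∀ i, μ (⋃ j ∈ s i, B j \ E) ≤ ENNReal.ofReal ((1 - l) / l) * μ E := by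
    intro i
    have := (hs i).to_subtype
    calc μ (⋃ j ∈ s i, B j \ E) ≤ ∑' j : s i, μ (B j \ E) := measure_biUnion_le μ (hs i) _
      _ ≤ ∑' j : s i, ENNReal.ofReal ((1 - l) / l) * μ (B j ∩ E) :=
          ENNReal.tsum_le_tsum fun j =>
            measure_diff_le_of_density hl hE (hBf j) (hdens i j j.2)
      _ = ENNReal.ofReal ((1 - l) / l) * ∑' j : s i, μ (B j ∩ E) := ENNReal.tsum_mul_left
      _ = ENNReal.ofReal ((1 - l) / l) * μ (⋃ j ∈ s i, B j ∩ E) := by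
          rw [measure_biUnion (hs i) ((hdisj i).mono fun j => Set.inter_subset_left)
            fun j _ => (hBm j).inter hE]
      _ ≤ ENNReal.ofReal ((1 - l) / l) * μ E := by
          gcongr
          exact Set.iUnion₂_subset fun j _ => Set.inter_subset_right
  calc μ (E ∪ A) ≤ μ (E ∪ ⋃ i, ⋃ j ∈ s i, B j \ E) := by
        apply measure_mono
        rintro x (hx | hx)
        · exact Or.inl hx
        · by_cases hxE : x ∈ E
          · exact Or.inl hxE
          · right
            have := hA hx
            simp only [Set.mem_iUnion] at this ⊢
            obtain ⟨i, j, hj, hxj⟩ := this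
            exact ⟨i, j, hj, hxj, hxE⟩
    _ ≤ μ E + ∑ i, μ (⋃ j ∈ s i, B j \ E) :=
        (measure_union_le _ _).trans (add_le_add le_rfl (measure_iUnion_fintype_le _ _))
    _ ≤ μ E + ∑ _i : Fin N, ENNReal.ofReal ((1 - l) / l) * μ E := by
        gcongr with i
        exact hfam i
    _ = ENNReal.ofReal (1 + N * ((1 - l) / l)) * μ E := by
        rw [ENNReal.ofReal_add zero_le_one (by positivity), ENNReal.ofReal_mul (by positivity)]
        simp [add_mul, mul_assoc]

/-- A basis of neighborhoods `b j x`, `j ∈ ℤ`, on a measure space whose halo function is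
controlled by a covering constant `N`. -/
structure IsHaloBasis {Y : Type*} [MeasureSpace Y] (N : ℕ) (b : ℤ → Y → Set Y) : Prop where
  measurableSet_rel : ∀ j, MeasurableSet {p : Y × Y | p.2 ∈ b j p.1}
  pos : ∀ j x, volume (b j x) ≠ 0
  finite : ∀ j x, volume (b j x) ≠ ⊤
  halo : ∀ l : ℝ, 0 < l → l < 1 → ∀ E : Set Y, MeasurableSet E →
    volume (E ∪ {x | ∃ j, ENNReal.ofReal l * volume (b j x) < volume (b j x ∩ E)}) ≤
      ENNReal.ofReal (1 + N * ((1 - l) / l)) * volume E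

theorem IsHaloBasis.mono {Y : Type*} [MeasureSpace Y] {N M : ℕ} {b : ℤ → Y → Set Y}
    (h : IsHaloBasis N b) (hNM : N ≤ M) : IsHaloBasis M b where
  measurableSet_rel := h.measurableSet_rel
  pos := h.pos
  finite := h.finite
  halo l hl hl1 E hE := by
    refine (h.halo l hl hl1 E hE).trans ?_
    have : 0 ≤ (1 - l) / l := div_nonneg (by linarith) hl.le
    gcongr

/-- Closed balls with radii powers of two. -/
def ballBasis (n : ℕ) (j : ℤ) (x : Fin n → ℝ) : Set (Fin n → ℝ) :=
  Metric.closedBall x (2 ^ j)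

/-- The dyadic cubes containing a given point. -/
def dyadicBasis (n : ℕ) (j : ℤ) (x : Fin n → ℝ) : Set (Fin n → ℝ) :=
  dyadicCube (j, dyadicIndex j x)

theorem exists_scale_bound_of_density {n : ℕ} (hn : 0 < n) {l : ℝ} (hl : 0 < l)
    {E : Set (Fin n → ℝ)} (hE : volume E ≠ ⊤) :
    ∃ B : ℤ, ∀ k : ℤ, ∀ S : Set (Fin n → ℝ), ENNReal.ofReal ((2 ^ k) ^ n) ≤ volume S →
      ENNReal.ofReal l * volume S < volume (S ∩ E) → k ≤ B := by
  have hl' : ENNReal.ofReal l ≠ 0 := by simpa using hl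
  obtain ⟨B, hB⟩ := exists_scale_bound hn (v := volume E / ENNReal.ofReal l)
    (ENNReal.div_ne_top hE hl')
  refine ⟨B, fun k S hS h => hB k (hS.trans ?_)⟩
  rw [ENNReal.le_div_iff_mul_le (Or.inl hl') (Or.inl ENNReal.ofReal_ne_top), mul_comm]
  exact h.le.trans (measure_mono Set.inter_subset_right)

theorem mul_volume_eq_top {Y : Type*} [MeasureSpace Y] {l : ℝ} (hl : 0 < l) (hl1 : l < 1) (N : ℕ)
    {E : Set Y} (hE : volume E = ⊤) :
    ENNReal.ofReal (1 + N * ((1 - l) / l)) * volume E = ⊤ := by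
  have : 0 ≤ (1 - l) / l := div_nonneg (by linarith) hl.le
  rw [hE, ENNReal.mul_top]
  have : 0 < 1 + N * ((1 - l) / l) := by positivity
  simpa using this

theorem exists_isHaloBasis_ballBasis {n : ℕ} (hn : 0 < n) : ∃ N, IsHaloBasis N (ballBasis n) := by
  obtain ⟨N, τ, hτ, hN⟩ := HasBesicovitchCovering.no_satelliteConfig (α := Fin n → ℝ)
  refine ⟨N, ?_, ?_, ?_, ?_⟩
  · intro j
    exact (isClosed_le (continuous_snd.dist continuous_fst) continuous_const).measurableSet
  · intro j x
    rw [ballBasis, volume_closedBall_two_zpow]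
    simp only [ne_eq, ENNReal.ofReal_eq_zero, not_le]
    positivity
  · intro j x
    rw [ballBasis, volume_closedBall_two_zpow]
    exact ENNReal.ofReal_ne_top
  · intro l hl hl1 E hE
    by_cases hEf : volume E = ⊤
    · rw [mul_volume_eq_top hl hl1 N hEf]
      exact le_top
    obtain ⟨B, hB⟩ := exists_scale_bound_of_density hn hl hEf
    set A := {x | ∃ j, ENNReal.ofReal l * volume (ballBasis n j x) < volume (ballBasis n j x ∩ E)}
      with hA
    choose! r hr using fun x (hx : x ∈ A) => hx
    have hrB : ∀ x ∈ A, r x + 1 ≤ B := fun x hx =>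
      hB _ (ballBasis n (r x) x) (by rw [ballBasis, volume_closedBall_two_zpow]) (hr x hx)
    obtain ⟨s, hs, hcov⟩ := Besicovitch.exist_disjoint_covering_families hτ hN
      (⟨fun x => x, fun x => 2 ^ (r x), fun x => by positivity, 2 ^ B, fun x =>
        zpow_le_zpow_right₀ one_le_two (by have := hrB x x.2; lia)⟩ :
        Besicovitch.BallPackage A (Fin n → ℝ))
    refine measure_union_le_of_covering hl hl1 hE s
      (fun i => (hs i).countable_of_nonempty_interior fun x _ => ?_)
      (fun x : A => Metric.closedBall (x : Fin n → ℝ) (2 ^ (r x)))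
      (fun x => measurableSet_closedBall) (fun x => ?_) hs ?_ (fun i x _ => (hr x x.2).le)
    · refine ⟨x, Metric.ball_subset_interior_closedBall (Metric.mem_ball_self (by positivity))⟩
    · rw [volume_closedBall_two_zpow]
      exact ENNReal.ofReal_ne_top
    · intro x hx
      have := hcov ⟨⟨x, hx⟩, rfl⟩
      simp only [Set.mem_iUnion] at this ⊢
      obtain ⟨i, j, hj, hxj⟩ := this
      exact ⟨i, j, hj, Metric.ball_subset_closedBall hxj⟩

theorem isHaloBasis_dyadicBasis {n : ℕ} (hn : 0 < n) : IsHaloBasis 1 (dyadicBasis n) where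
  measurableSet_rel j :=
    measurableSet_eq_fun ((measurable_dyadicIndex j).comp measurable_snd)
      ((measurable_dyadicIndex j).comp measurable_fst)
  pos j x := by
    rw [dyadicBasis, volume_dyadicCube]
    simp only [ne_eq, ENNReal.ofReal_eq_zero, not_le]
    positivity
  finite j x := by
    rw [dyadicBasis, volume_dyadicCube]
    exact ENNReal.ofReal_ne_top
  halo l hl hl1 E hE := by
    by_cases hEf : volume E = ⊤
    · rw [mul_volume_eq_top hl hl1 1 hEf]
      exact le_top
    obtain ⟨B, hB⟩ := exists_scale_bound_of_density hn hl hEf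
    obtain ⟨top, htop, hdisj⟩ := exists_maximal_dyadicCube
      {Q : ℤ × (Fin n → ℤ) | ENNReal.ofReal l * volume (dyadicCube Q) < volume (dyadicCube Q ∩ E)} B
      (fun Q hQ => hB _ (dyadicCube Q) (by rw [volume_dyadicCube]) hQ)
    set T := {Q : ℤ × (Fin n → ℤ) |
      ENNReal.ofReal l * volume (dyadicCube Q) < volume (dyadicCube Q ∩ E)} with hT
    refine measure_union_le_of_covering hl hl1 hE (fun _ => top '' T) (fun _ => Set.to_countable _)
      dyadicCube measurableSet_dyadicCube (fun Q => ?_) ?_ ?_ ?_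
    · rw [volume_dyadicCube]
      exact ENNReal.ofReal_ne_top
    · rintro - _ ⟨Q, hQ, rfl⟩ _ ⟨Q', hQ', rfl⟩ hne
      refine Set.disjoint_left.2 fun y hy hy' => hne (hdisj Q hQ Q' hQ' y hy hy')
    · rintro x ⟨j, hj⟩
      simp only [Set.mem_iUnion]
      exact ⟨0, top (j, dyadicIndex j x), ⟨_, hj, rfl⟩,
        (htop _ hj).2.2 (mem_dyadicCube_dyadicIndex j x)⟩
    · rintro - _ ⟨Q, hQ, rfl⟩
      exact (htop Q hQ).1.le

theorem volume_boundary_layer_le {n : ℕ} (Q : ℤ × (Fin n → ℤ)) {h : ℝ} (hh : 0 < h) :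
    volume {y | y ∈ dyadicCube Q ∧ ¬ Metric.closedBall y h ⊆ dyadicCube Q} ≤
      ENNReal.ofReal (2 * n * (h / 2 ^ Q.1)) * volume (dyadicCube Q) := by
  set L : ℝ := 2 ^ Q.1 with hL
  have hLpos : 0 < L := by positivity
  set a : Fin n → ℝ := fun i => L * Q.2 i with ha
  set lower : Fin n → Set (Fin n → ℝ) := fun i => Set.pi Set.univ fun j =>
    Set.Ico (a j) (if j = i then a j + h else a j + L) with hlower
  set upper : Fin n → Set (Fin n → ℝ) := fun i => Set.pi Set.univ fun j =>
    Set.Ico (if j = i then a j + L - h else a j) (a j + L) with hupper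
  have hprod : ∀ i : Fin n, ∏ j : Fin n, ENNReal.ofReal (if j = i then h else L) =
      ENNReal.ofReal (h / L) * volume (dyadicCube Q) := by
    intro i
    rw [volume_dyadicCube, ← ENNReal.ofReal_mul (by positivity),
      ← ENNReal.ofReal_prod_of_nonneg (fun j _ => by split_ifs <;> positivity),
      Finset.prod_ite, Finset.filter_eq', Finset.filter_ne']
    have hn : n = (n - 1) + 1 := by have := i.pos; lia
    congr 1
    simp only [Finset.mem_univ, if_true, Finset.prod_const, Finset.card_singleton, pow_one,
      Finset.card_erase_of_mem, Finset.card_univ, Fintype.card_fin, ← hL]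
    nth_rw 2 [hn]
    rw [pow_succ]
    field_simp
  have hvl : ∀ i, volume (lower i) = ENNReal.ofReal (h / L) * volume (dyadicCube Q) := by
    intro i
    rw [← hprod i, hlower, Real.volume_pi_Ico]
    refine Finset.prod_congr rfl fun j _ => ?_
    congr 1
    split_ifs <;> ring
  have hvu : ∀ i, volume (upper i) = ENNReal.ofReal (h / L) * volume (dyadicCube Q) := by
    intro i
    rw [← hprod i, hupper, Real.volume_pi_Ico]
    refine Finset.prod_congr rfl fun j _ => ?_
    congr 1
    split_ifs <;> ring
  have hsub : {y | y ∈ dyadicCube Q ∧ ¬ Metric.closedBall y h ⊆ dyadicCube Q} ⊆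
      ⋃ i, (lower i ∪ upper i) := by
    rintro y ⟨hy, hball⟩
    obtain ⟨z, hz, hzQ⟩ := Set.not_subset.1 hball
    rw [mem_dyadicCube] at hy hzQ
    push Not at hzQ
    obtain ⟨i, hi⟩ := hzQ
    rw [Metric.mem_closedBall, dist_pi_le_iff hh.le] at hz
    have hzi := hz i
    rw [Real.dist_eq, abs_le] at hzi
    have hy' : ∀ j, a j ≤ y j ∧ y j < a j + L := fun j => by
      have := hy j
      rw [← hL, mul_add, mul_one] at this
      exact this
    rw [← hL, mul_add, mul_one, Set.mem_Ico, not_and_or, not_le, not_lt] at hi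
    refine Set.mem_iUnion.2 ⟨i, ?_⟩
    rcases hi with hi | hi
    · left
      intro j _
      refine ⟨(hy' j).1, ?_⟩
      split_ifs with hji
      · subst hji
        simp only [ha]
        linarith
      · exact (hy' j).2
    · right
      intro j _
      refine ⟨?_, (hy' j).2⟩
      split_ifs with hji
      · subst hji
        simp only [ha]
        linarith
      · exact (hy' j).1
  calc _ ≤ volume (⋃ i, (lower i ∪ upper i)) := measure_mono hsub
    _ ≤ ∑ i, (volume (lower i) + volume (upper i)) :=
        (measure_iUnion_fintype_le _ _).trans (Finset.sum_le_sum fun i _ => measure_union_le _ _)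
    _ = ENNReal.ofReal (2 * n * (h / L)) * volume (dyadicCube Q) := by
        simp only [hvl, hvu, Finset.sum_const, Finset.card_univ, Fintype.card_fin, nsmul_eq_mul]
        rw [← two_mul, ENNReal.ofReal_mul (by positivity), ENNReal.ofReal_mul (by positivity)]
        simp only [ENNReal.ofReal_ofNat, ENNReal.ofReal_natCast]
        ring

/-- The dyadic subcubes of `P` whose concentric dilate by `2 ^ (m + 1)` leaves `P` have total
volume at most a multiple of `2 ^ m` times the volume of `P`. -/
theorem tsum_volume_le_of_not_closedBall_subset {n : ℕ} (m : ℕ) (P : ℤ × (Fin n → ℤ))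
    (S : Set (ℤ × (Fin n → ℤ))) (hS : ∀ Q ∈ S, Q.1 ≤ P.1 ∧ dyadicCube Q ⊆ dyadicCube P ∧
      ¬ Metric.closedBall (dyadicCenter Q) (2 ^ (m + Q.1)) ⊆ dyadicCube P) :
    ∑' Q : S, volume (dyadicCube (Q : ℤ × (Fin n → ℤ))) ≤
      ENNReal.ofReal (n * 2 ^ (m + 3)) * volume (dyadicCube P) := by
  set g : S → ℕ := fun Q => (P.1 - Q.1.1).toNat with hg
  have hgQ : ∀ Q : S, ∀ i : ℕ, g Q = i → Q.1.1 = P.1 - i := by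
    intro Q i hi
    have := (hS Q Q.2).1
    simp only [hg] at hi
    lia
  have hgen : ∀ i : ℕ, ∑' Q : g ⁻¹' {i}, volume (dyadicCube (Q : S).1) ≤
      ENNReal.ofReal (n * 2 ^ (m + 2)) * volume (dyadicCube P) * 2⁻¹ ^ i := by
    intro i
    have hh : (0 : ℝ) < 2 ^ (m + 1 + (P.1 - i)) := by positivity
    calc ∑' Q : g ⁻¹' {i}, volume (dyadicCube (Q : S).1)
        ≤ volume (⋃ Q : g ⁻¹' {i}, dyadicCube (Q : S).1) := by
          refine tsum_meas_le_meas_iUnion_of_disjoint volume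
            (fun Q => measurableSet_dyadicCube _) fun Q Q' hne => ?_
          refine Set.disjoint_left.2 fun y hy hy' => hne (Subtype.ext (Subtype.ext ?_))
          have h1 := (hgQ Q.1 i Q.2).trans (hgQ Q'.1 i Q'.2).symm
          refine Prod.ext h1 ?_
          rw [← (show dyadicIndex _ y = _ from hy), ← (show dyadicIndex _ y = _ from hy'), h1]
      _ ≤ volume {y | y ∈ dyadicCube P ∧
            ¬ Metric.closedBall y (2 ^ (m + 1 + (P.1 - i))) ⊆ dyadicCube P} := by
          refine measure_mono (Set.iUnion_subset fun Q y hy => ?_)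
          have hQ := hS _ (Q : S).2
          refine ⟨hQ.2.1 hy, fun hsub => hQ.2.2 (subset_trans ?_ hsub)⟩
          apply Metric.closedBall_subset_closedBall'
          have h1 := Metric.mem_closedBall'.1 (dyadicCube_subset_closedBall _ hy)
          rw [hgQ Q.1 i Q.2] at h1 ⊢
          have h2 : (2 : ℝ) ^ (P.1 - i - 1) ≤ 2 ^ (m + (P.1 - i)) :=
            zpow_le_zpow_right₀ one_le_two (by lia)
          have h3 : (2 : ℝ) ^ (m + 1 + (P.1 - i)) = 2 ^ (m + (P.1 - i)) * 2 := by
            rw [← zpow_add_one₀ two_ne_zero]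
            ring_nf
          rw [dist_comm] at h1 ⊢
          rw [h3]
          linarith
      _ ≤ _ := volume_boundary_layer_le P hh
      _ = _ := by
          have : 2 * (n : ℝ) * (2 ^ (m + 1 + (P.1 - i)) / 2 ^ P.1) =
              n * 2 ^ (m + 2) * 2⁻¹ ^ i := by
            rw [zpow_add₀ two_ne_zero, zpow_sub₀ two_ne_zero, zpow_add₀ two_ne_zero]
            simp only [zpow_natCast, zpow_one, inv_pow]
            field_simp
            ring
          rw [this, ENNReal.ofReal_mul (by positivity), ENNReal.ofReal_pow (by positivity),
            ENNReal.ofReal_inv_of_pos two_pos, ENNReal.ofReal_ofNat]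
          ring
  rw [← ENNReal.tsum_fiberwise _ g]
  refine (ENNReal.tsum_le_tsum hgen).trans (le_of_eq ?_)
  rw [ENNReal.tsum_mul_left, ENNReal.tsum_geometric, ENNReal.one_sub_inv_two, inv_inv,
    pow_succ _ (m + 2), ← mul_assoc, ENNReal.ofReal_mul (p := n * 2 ^ (m + 2)) (by positivity),
    ENNReal.ofReal_ofNat]
  ring

theorem tsum_volume_dyadicCube_le {n : ℕ} (hn : 0 < n) (m : ℕ) (T : Set (ℤ × (Fin n → ℤ)))
    (hT : ∀ Q ∈ T, ∀ Q' ∈ T,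
      ¬ Metric.closedBall (dyadicCenter Q) (2 ^ (m + Q.1)) ⊆ dyadicCube Q') :
    ∑' Q : T, volume (dyadicCube (Q : ℤ × (Fin n → ℤ))) ≤
      ENNReal.ofReal (n * 2 ^ (m + 3)) * volume (⋃ Q ∈ T, dyadicCube Q) := by
  by_cases hv : volume (⋃ Q ∈ T, dyadicCube Q) = ⊤
  · rw [hv, ENNReal.mul_top]
    · exact le_top
    · simpa using hn.ne'
  obtain ⟨B, hB⟩ := exists_scale_bound hn hv
  obtain ⟨top, htop, hdisj⟩ := exists_maximal_dyadicCube T B (fun Q hQ => hB _ (by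
    rw [← volume_dyadicCube]
    exact measure_mono (Set.subset_biUnion_of_mem (u := dyadicCube) hQ)))
  set g : T → ℤ × (Fin n → ℤ) := fun Q => top Q with hg
  have hfib : ∀ P, ∑' Q : g ⁻¹' {P}, volume (dyadicCube (Q : T).1) ≤
      (top '' T).indicator
        (fun P => ENNReal.ofReal (n * 2 ^ (m + 3)) * volume (dyadicCube P)) P := by
    intro P
    by_cases hP : P ∈ top '' T
    · rw [Set.indicator_of_mem hP]
      have hPT : P ∈ T := by
        obtain ⟨Q, hQ, rfl⟩ := hP
        exact (htop Q hQ).1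
      refine le_trans (le_of_eq ?_) (tsum_volume_le_of_not_closedBall_subset m P
        {Q | Q ∈ T ∧ top Q = P} ?_)
      · exact Equiv.tsum_eq (Equiv.subtypeSubtypeEquivSubtypeInter (· ∈ T) (fun Q => top Q = P))
          (fun Q => volume (dyadicCube (Q : ℤ × (Fin n → ℤ))))
      · rintro Q ⟨hQ, rfl⟩
        exact ⟨(htop Q hQ).2.1, (htop Q hQ).2.2, hT Q hQ _ hPT⟩
    · have : IsEmpty (g ⁻¹' {P}) := ⟨fun Q => hP ⟨Q.1.1, Q.1.2, Q.2⟩⟩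
      simp
  rw [← ENNReal.tsum_fiberwise _ g]
  refine (ENNReal.tsum_le_tsum hfib).trans ?_
  rw [← tsum_subtype, ENNReal.tsum_mul_left]
  gcongr
  refine (tsum_meas_le_meas_iUnion_of_disjoint volume
    (fun Q => measurableSet_dyadicCube _) ?_).trans (measure_mono ?_)
  · rintro ⟨_, Q, hQ, rfl⟩ ⟨_, Q', hQ', rfl⟩ hne
    exact Set.disjoint_left.2 fun y hy hy' =>
      hne (Subtype.ext (hdisj Q hQ Q' hQ' y hy hy'))
  · refine Set.iUnion_subset ?_
    rintro ⟨_, Q, hQ, rfl⟩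
    exact Set.subset_biUnion_of_mem (u := dyadicCube) (htop Q hQ).1

section Halo

variable {ι : Type*} [DecidableEq ι] {Y : ι → Type*} [∀ i, MeasureSpace (Y i)]

theorem measurableSet_slice {E : Set (∀ i, Y i)} (hE : MeasurableSet E) (i : ι) (x : ∀ i, Y i) :
    MeasurableSet {y | Function.update x i y ∈ E} :=
  (measurable_update x) hE

/-- The set `E` together with the points at which it has density larger than `l` in some basis
set taken in the coordinate `i`. -/
def coordHalo (l : ℝ) (i : ι) (b : ℤ → Y i → Set (Y i)) (E : Set (∀ i, Y i)) :
    Set (∀ i, Y i) :=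
  E ∪ {x | ∃ j, ENNReal.ofReal l * volume (b j (x i)) <
    volume (b j (x i) ∩ {y | Function.update x i y ∈ E})}

theorem coordHalo_mono (l : ℝ) (i : ι) (b : ℤ → Y i → Set (Y i)) {E F : Set (∀ i, Y i)}
    (h : E ⊆ F) : coordHalo l i b E ⊆ coordHalo l i b F := by
  rintro x (hx | ⟨j, hj⟩)
  · exact Or.inl (h hx)
  · exact Or.inr ⟨j, hj.trans_le
      (measure_mono (Set.inter_subset_inter_right _ fun y hy => h hy))⟩

/-- The iteration of `coordHalo` over the coordinates in a list. -/
def iteratedHalo (l : ℝ) (b : ∀ i, ℤ → Y i → Set (Y i)) (L : List ι) (E : Set (∀ i, Y i)) :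
    Set (∀ i, Y i) :=
  L.foldr (fun i F => coordHalo l i (b i) F) E

theorem subset_iteratedHalo (l : ℝ) (b : ∀ i, ℤ → Y i → Set (Y i)) (L : List ι)
    (E : Set (∀ i, Y i)) : E ⊆ iteratedHalo l b L E := by
  induction L with
  | nil => exact subset_rfl
  | cons i L ih => exact ih.trans Set.subset_union_left

theorem iteratedHalo_mono (l : ℝ) (b : ∀ i, ℤ → Y i → Set (Y i)) (L : List ι)
    {E F : Set (∀ i, Y i)} (h : E ⊆ F) : iteratedHalo l b L E ⊆ iteratedHalo l b L F := by
  induction L with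
  | nil => exact h
  | cons i L ih => exact coordHalo_mono l i (b i) ih

variable [∀ i, SigmaFinite (volume : Measure (Y i))]

theorem measurableSet_coordHalo {l : ℝ} {i : ι} {N : ℕ} {b : ℤ → Y i → Set (Y i)}
    (hb : IsHaloBasis N b) {E : Set (∀ i, Y i)} (hE : MeasurableSet E) :
    MeasurableSet (coordHalo l i b E) := by
  refine hE.union ?_
  have : {x : ∀ i, Y i | ∃ j, ENNReal.ofReal l * volume (b j (x i)) <
      volume (b j (x i) ∩ {y | Function.update x i y ∈ E})} =
      ⋃ j, {x | ENNReal.ofReal l * volume (b j (x i)) <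
        volume (b j (x i) ∩ {y | Function.update x i y ∈ E})} := by
    ext x
    simp
  rw [this]
  refine MeasurableSet.iUnion fun j => ?_
  have h1 : MeasurableSet {p : (∀ i, Y i) × Y i | p.2 ∈ b j (p.1 i)} :=
    (hb.measurableSet_rel j).preimage
      (((measurable_pi_apply i).comp measurable_fst).prodMk measurable_snd)
  have h2 : MeasurableSet {p : (∀ i, Y i) × Y i | Function.update p.1 i p.2 ∈ E} := by
    refine hE.preimage (f := fun p : (∀ i, Y i) × Y i => Function.update p.1 i p.2) ?_
    exact measurable_update'
  exact measurableSet_lt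
    ((measurable_measure_prodMk_left h1).const_mul _)
    (measurable_measure_prodMk_left (h1.inter h2))

theorem measurableSet_iteratedHalo {l : ℝ} {N : ℕ} {b : ∀ i, ℤ → Y i → Set (Y i)}
    (hb : ∀ i, IsHaloBasis N (b i)) (L : List ι) {E : Set (∀ i, Y i)} (hE : MeasurableSet E) :
    MeasurableSet (iteratedHalo l b L E) := by
  induction L with
  | nil => exact hE
  | cons i L ih => exact measurableSet_coordHalo (hb i) ih

theorem lmarginal_indicator_le_of_notMem_iteratedHalo {l : ℝ} (hl : 0 < l) (hl1 : l < 1) {N : ℕ}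
    {b : ∀ i, ℤ → Y i → Set (Y i)} (hb : ∀ i, IsHaloBasis N (b i)) {E : Set (∀ i, Y i)}
    (hE : MeasurableSet E) (c : ∀ i, Y i) (j : ι → ℤ) (L : List ι) (hL : L.Nodup)
    (x : ∀ i, Y i) (hx : ∀ i ∈ L, x i = c i) (hxE : x ∉ iteratedHalo l b L E) :
    lmarginal (fun i => (volume : Measure (Y i)).restrict (b i (j i) (c i))) L.toFinset
        (E.indicator 1) x ≤
      ENNReal.ofReal (1 - (1 - l) ^ L.length) * (L.map fun i => volume (b i (j i) (c i))).prod := by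
  induction L generalizing x with
  | nil =>
    simp only [List.toFinset_nil, lmarginal_empty]
    simpa [iteratedHalo] using hxE
  | cons i L ih =>
    obtain ⟨hiL, hLn⟩ := List.nodup_cons.1 hL
    set G := iteratedHalo l b L E with hG
    have hGm : MeasurableSet G := measurableSet_iteratedHalo hb L hE
    set p := (L.map fun i => volume (b i (j i) (c i))).prod with hp
    set n := L.length with hn
    have hl2 : 0 ≤ 1 - l := by linarith
    have hpow : (1 - l) ^ n ≤ 1 := pow_le_one₀ hl2 (by linarith)
    have hxG : ENNReal.ofReal l * volume (b i (j i) (c i)) ≥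
        volume ({y | Function.update x i y ∈ G} ∩ b i (j i) (c i)) := by
      by_contra! h
      refine hxE (Or.inr ⟨j i, ?_⟩)
      rw [hx i List.mem_cons_self, Set.inter_comm]
      exact h
    have hpoint : ∀ y, lmarginal (fun i => (volume : Measure (Y i)).restrict (b i (j i) (c i)))
        L.toFinset (E.indicator 1) (Function.update x i y) ≤
        p * (ENNReal.ofReal (1 - (1 - l) ^ n) +
          ENNReal.ofReal ((1 - l) ^ n) *
            {y | Function.update x i y ∈ G}.indicator 1 y) := by
      intro y
      by_cases hy : Function.update x i y ∈ G
      · rw [Set.indicator_of_mem (by exact hy), Pi.one_apply, mul_one,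
          ← ENNReal.ofReal_add (by linarith) (by positivity), sub_add_cancel, ENNReal.ofReal_one,
          mul_one]
        calc _ ≤ lmarginal (fun i => (volume : Measure (Y i)).restrict (b i (j i) (c i)))
              L.toFinset 1 (Function.update x i y) :=
              lmarginal_mono (Set.indicator_le_self _ _) _
          _ = p := by
              simp only [lmarginal, Pi.one_apply, lintegral_const, one_mul, Measure.pi_univ,
                Measure.restrict_apply_univ]
              rw [Finset.prod_coe_sort L.toFinset (fun i => volume (b i (j i) (c i))), hp,
                List.prod_toFinset _ hLn]
      · rw [Set.indicator_of_notMem (by exact hy), mul_zero, add_zero, mul_comm p]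
        refine ih hLn _ (fun k hk => ?_) hy
        rw [Function.update_of_ne (by rintro rfl; exact hiL hk)]
        exact hx k (List.mem_cons_of_mem _ hk)
    rw [List.toFinset_cons, lmarginal_insert _ (measurable_one.indicator hE) (by simpa using hiL)]
    have hSm : MeasurableSet {y | Function.update x i y ∈ G} := measurableSet_slice hGm i x
    calc _ ≤ ∫⁻ y in b i (j i) (c i), p * (ENNReal.ofReal (1 - (1 - l) ^ n) +
          ENNReal.ofReal ((1 - l) ^ n) *
            {y | Function.update x i y ∈ G}.indicator 1 y) := lintegral_mono hpoint
      _ = p * (ENNReal.ofReal (1 - (1 - l) ^ n) * volume (b i (j i) (c i)) +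
          ENNReal.ofReal ((1 - l) ^ n) *
            volume ({y | Function.update x i y ∈ G} ∩ b i (j i) (c i))) := by
          have hm : Measurable ({y | Function.update x i y ∈ G}.indicator (1 : Y i → ℝ≥0∞)) :=
            measurable_one.indicator hSm
          rw [lintegral_const_mul _ ((hm.const_mul _).const_add _),
            lintegral_add_left measurable_const, lintegral_const_mul _ hm,
            lintegral_indicator_one hSm, Measure.restrict_apply hSm]
          simp
      _ ≤ p * (ENNReal.ofReal (1 - (1 - l) ^ n) * volume (b i (j i) (c i)) +
          ENNReal.ofReal ((1 - l) ^ n) * (ENNReal.ofReal l * volume (b i (j i) (c i)))) := by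
          gcongr
      _ = _ := by
          rw [List.map_cons, List.prod_cons, List.length_cons, ← hp, ← hn, ← mul_assoc,
            ← ENNReal.ofReal_mul (by positivity), ← add_mul,
            ← ENNReal.ofReal_add (by linarith) (by positivity), mul_left_comm, ← mul_assoc, mul_assoc]
          have : 1 - (1 - l) ^ n + (1 - l) ^ n * l = 1 - (1 - l) ^ (n + 1) := by ring
          rw [this]
          ring

variable [Fintype ι]

theorem lintegral_le_of_lintegral_update_le {f g : (∀ i, Y i) → ℝ≥0∞} (hf : Measurable f)
    (hg : Measurable g) (i : ι)
    (h : ∀ x, ∫⁻ y, f (Function.update x i y) ≤ ∫⁻ y, g (Function.update x i y)) :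
    ∫⁻ x, f x ≤ ∫⁻ x, g x := by
  refine lintegral_le_of_lmarginal_le {i} hf hg ?_
  rw [lmarginal_singleton, lmarginal_singleton]
  exact h

theorem volume_le_of_volume_slice_le {A E : Set (∀ i, Y i)} (hA : MeasurableSet A)
    (hE : MeasurableSet E) (i : ι) (c : ℝ≥0∞)
    (h : ∀ x, volume {y | Function.update x i y ∈ A} ≤
      c * volume {y | Function.update x i y ∈ E}) :
    volume A ≤ c * volume E := by
  have key : ∫⁻ x, A.indicator 1 x ≤ ∫⁻ x, c * E.indicator 1 x := by
    refine lintegral_le_of_lintegral_update_le (measurable_one.indicator hA)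
      ((measurable_one.indicator hE).const_mul c) i fun x => ?_
    have h1 : ∀ F : Set (∀ i, Y i), MeasurableSet F →
        ∫⁻ y, F.indicator (1 : (∀ i, Y i) → ℝ≥0∞) (Function.update x i y) =
          volume {y | Function.update x i y ∈ F} := fun F hF =>
      lintegral_indicator_one (measurableSet_slice hF i x)
    rw [lintegral_const_mul c (f := fun y => E.indicator 1 (Function.update x i y))
      ((measurable_one.indicator hE).comp (measurable_update x)), h1 A hA, h1 E hE]
    exact h x
  rwa [lintegral_const_mul _ (measurable_one.indicator hE), lintegral_indicator_one hA,
    lintegral_indicator_one hE] at key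

theorem volume_coordHalo_le {l : ℝ} (hl : 0 < l) (hl1 : l < 1) {i : ι} {N : ℕ}
    {b : ℤ → Y i → Set (Y i)} (hb : IsHaloBasis N b) {E : Set (∀ i, Y i)}
    (hE : MeasurableSet E) :
    volume (coordHalo l i b E) ≤ ENNReal.ofReal (1 + N * ((1 - l) / l)) * volume E := by
  refine volume_le_of_volume_slice_le (measurableSet_coordHalo hb hE) hE i _ fun x => ?_
  refine le_trans (le_of_eq ?_) (hb.halo l hl hl1 _ (measurableSet_slice hE i x))
  congr 1
  ext y
  simp [coordHalo]

theorem volume_iteratedHalo_le {l : ℝ} (hl : 0 < l) (hl1 : l < 1) {N : ℕ}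
    {b : ∀ i, ℤ → Y i → Set (Y i)} (hb : ∀ i, IsHaloBasis N (b i)) (L : List ι)
    {E : Set (∀ i, Y i)} (hE : MeasurableSet E) :
    volume (iteratedHalo l b L E) ≤
      ENNReal.ofReal (1 + N * ((1 - l) / l)) ^ L.length * volume E := by
  induction L with
  | nil => simp [iteratedHalo]
  | cons i L ih =>
    refine (volume_coordHalo_le hl hl1 (hb i) (measurableSet_iteratedHalo hb L hE)).trans ?_
    rw [List.length_cons, pow_succ', mul_assoc]
    gcongr

/-- The points at which `E` has large density in some product of basis sets lie in the iterated
halo of `E`. -/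
theorem mem_iteratedHalo_of_density {l : ℝ} (hl : 0 < l) (hl1 : l < 1) {N : ℕ}
    {b : ∀ i, ℤ → Y i → Set (Y i)} (hb : ∀ i, IsHaloBasis N (b i)) {E : Set (∀ i, Y i)}
    (hE : MeasurableSet E) (x : ∀ i, Y i) (j : ι → ℤ)
    (h : ENNReal.ofReal (1 - (1 - l) ^ Fintype.card ι) *
        volume (Set.pi Set.univ fun i => b i (j i) (x i)) <
      volume (E ∩ Set.pi Set.univ fun i => b i (j i) (x i))) :
    x ∈ iteratedHalo l b (Finset.univ : Finset ι).toList E := by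
  by_contra hx
  have := lmarginal_indicator_le_of_notMem_iteratedHalo hl hl1 hb hE x j _
    (Finset.nodup_toList _) x (fun _ _ => rfl) hx
  rw [Finset.toList_toFinset, lmarginal_univ, lintegral_indicator_one hE,
    ← Measure.restrict_pi_pi, Measure.restrict_apply hE, Finset.prod_map_toList,
    Finset.length_toList, Finset.card_univ] at this
  rw [volume_pi, Measure.pi_pi] at h
  exact absurd h (not_lt.2 this)

end Halo

/-- The product `ℝ^{d₁} × ⋯ × ℝ^{d_t}` as an iterated function space. -/
abbrev ProdSpace (t : ℕ) (d : Fin t → ℕ) := (s : Fin t) → Fin (d s) → ℝ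

/-- The basis of closed balls in the first `s` coordinates, of dyadic cubes in the others. -/
def mixedBasis (d : Fin t → ℕ) (s : ℕ) (r : Fin t) : ℤ → (Fin (d r) → ℝ) → Set (Fin (d r) → ℝ) :=
  if (r : ℕ) < s then ballBasis (d r) else dyadicBasis (d r)

theorem exists_isHaloBasis_mixedBasis (hd : ∀ s, 0 < d s) :
    ∃ N, ∀ s r, IsHaloBasis N (mixedBasis d s r) := by
  choose N hN using fun r : Fin t => exists_isHaloBasis_ballBasis (hd r)
  refine ⟨1 + ∑ r, N r, fun s r => ?_⟩
  unfold mixedBasis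
  split_ifs
  · exact (hN r).mono
      ((Finset.single_le_sum (fun _ _ => Nat.zero_le _) (Finset.mem_univ r)).trans
        (Nat.le_add_left _ _))
  · exact (isHaloBasis_dyadicBasis (hd r)).mono (Nat.le_add_right _ _)

/-- The iterated halo for the basis `mixedBasis d s`. -/
def mixedHalo (l : ℝ) (s : ℕ) (E : Set (ProdSpace t d)) : Set (ProdSpace t d) :=
  iteratedHalo l (mixedBasis d s) (Finset.univ : Finset (Fin t)).toList E

theorem volume_mixedHalo_le {l : ℝ} (hl : 0 < l) (hl1 : l < 1) {N : ℕ} {s : ℕ}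
    (hb : ∀ r, IsHaloBasis N (mixedBasis d s r)) {E : Set (ProdSpace t d)}
    (hE : MeasurableSet E) :
    volume (mixedHalo l s E) ≤ ENNReal.ofReal (1 + N * ((1 - l) / l)) ^ t * volume E := by
  have := volume_iteratedHalo_le hl hl1 hb (Finset.univ : Finset (Fin t)).toList hE
  rwa [Finset.length_toList, Finset.card_univ, Fintype.card_fin] at this

/-- The side of a dyadic rectangle in a coordinate. -/
def DyadicRect.side (R : DyadicRect t d) (r : Fin t) : ℤ × (Fin (d r) → ℤ) := (R.k r, R.pos r)

/-- A dyadic rectangle as a subset of `ProdSpace t d`. -/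
def DyadicRect.box (R : DyadicRect t d) : Set (ProdSpace t d) :=
  Set.pi Set.univ fun r => dyadicCube (R.side r)

/-- The sides of `R`, dilated by `2 ^ (k r - (s - r))` in the coordinates `r < s`. -/
def DyadicRect.expandedSide (s : ℕ) (k : Fin t → ℕ) (R : DyadicRect t d) (r : Fin t) :
    Set (Fin (d r) → ℝ) :=
  if (r : ℕ) < s then
    Metric.closedBall (dyadicCenter (R.side r)) (2 ^ (k r + R.k r - 1 - ((s : ℤ) - r)))
  else dyadicCube (R.side r)

instance : Countable (DyadicRect t d) := by
  refine Function.Injective.countable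
    (f := fun R : DyadicRect t d => ((R.k, R.pos) : (Fin t → ℤ) × ((s : Fin t) → Fin (d s) → ℤ))) ?_
  rintro ⟨k, p⟩ ⟨k', p'⟩ h
  simpa using h

section ExpandedSide

variable (s : ℕ) (k : Fin t → ℕ) (R : DyadicRect t d) (r : Fin t)

theorem measurableSet_expandedSide : MeasurableSet (R.expandedSide s k r) := by
  unfold DyadicRect.expandedSide
  split_ifs
  · exact measurableSet_closedBall
  · exact measurableSet_dyadicCube _

theorem volume_expandedSide_ne_zero : volume (R.expandedSide s k r) ≠ 0 := by
  unfold DyadicRect.expandedSide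
  split_ifs
  · rw [volume_closedBall_two_zpow]
    simp only [ne_eq, ENNReal.ofReal_eq_zero, not_le]
    positivity
  · rw [volume_dyadicCube]
    simp only [ne_eq, ENNReal.ofReal_eq_zero, not_le]
    positivity

theorem volume_expandedSide_ne_top : volume (R.expandedSide s k r) ≠ ⊤ := by
  unfold DyadicRect.expandedSide
  split_ifs
  · rw [volume_closedBall_two_zpow]
    exact ENNReal.ofReal_ne_top
  · rw [volume_dyadicCube]
    exact ENNReal.ofReal_ne_top

end ExpandedSide

theorem volume_pi_update {ι : Type*} [Fintype ι] [DecidableEq ι] {Y : ι → Type*}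
    [∀ i, MeasureSpace (Y i)] [∀ i, SigmaFinite (volume : Measure (Y i))]
    (A : ∀ i, Set (Y i)) (i : ι) (B : Set (Y i)) :
    volume (Set.pi Set.univ (Function.update A i B)) =
      volume B * ∏ r ∈ Finset.univ.erase i, volume (A r) := by
  rw [volume_pi, Measure.pi_pi, ← Finset.mul_prod_erase _ _ (Finset.mem_univ i),
    Function.update_self]
  congr 1
  refine Finset.prod_congr rfl fun r hr => ?_
  rw [Function.update_of_ne (Finset.ne_of_mem_erase hr)]

theorem volume_pi_eq_mul_prod_erase {ι : Type*} [Fintype ι] [DecidableEq ι] {Y : ι → Type*}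
    [∀ i, MeasureSpace (Y i)] [∀ i, SigmaFinite (volume : Measure (Y i))]
    (A : ∀ i, Set (Y i)) (i : ι) :
    volume (Set.pi Set.univ A) = volume (A i) * ∏ r ∈ Finset.univ.erase i, volume (A r) := by
  rw [← volume_pi_update, Function.update_eq_self]

/-- If `W` has density close to one in `D`, it has density close to one in each subset of `D`
of comparable measure. -/
theorem density_of_subset {Y : Type*} [MeasurableSpace Y] {μ : Measure Y} {A D W : Set Y}
    (hA : MeasurableSet A) (hAD : A ⊆ D) (hD : μ D ≠ ⊤) {e M : ℝ} (he : 0 ≤ e) (he1 : e ≤ 1)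
    (hM : 1 ≤ M) (hDA : μ D ≤ ENNReal.ofReal M * μ A)
    (h : ENNReal.ofReal (1 - e / M) * μ D < μ (W ∩ D)) :
    ENNReal.ofReal (1 - e) * μ A < μ (W ∩ A) := by
  have hM0 : 0 < M := by linarith
  have heM : e / M ≤ 1 := (div_le_one hM0).2 (by linarith)
  have hAt : μ A ≠ ⊤ := ne_top_of_le_ne_top hD (measure_mono hAD)
  have hWA : μ (W ∩ A) ≠ ⊤ := ne_top_of_le_ne_top hAt (measure_mono Set.inter_subset_right)
  have hdiff : μ (D \ A) ≠ ⊤ := ne_top_of_le_ne_top hD (measure_mono Set.sdiff_subset)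
  have hsum : μ D = μ A + μ (D \ A) := by
    have := measure_inter_add_sdiff (μ := μ) D hA
    rwa [Set.inter_eq_self_of_subset_right hAD, eq_comm] at this
  have hcov : μ (W ∩ D) ≤ μ (W ∩ A) + μ (D \ A) := by
    refine (measure_mono ?_).trans (measure_union_le _ _)
    rintro x ⟨hxW, hxD⟩
    by_cases hxA : x ∈ A
    · exact Or.inl ⟨hxW, hxA⟩
    · exact Or.inr ⟨hxD, hxA⟩
  have h2 := h.trans_le hcov
  rw [← ENNReal.ofReal_toReal hAt, ← ENNReal.ofReal_toReal hD,
    ← ENNReal.ofReal_mul hM0.le, ENNReal.ofReal_le_ofReal_iff (by positivity)] at hDA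
  rw [← ENNReal.ofReal_toReal hAt, ← ENNReal.ofReal_toReal hdiff,
    ← ENNReal.ofReal_add (by positivity) (by positivity), ← ENNReal.ofReal_toReal hD,
    ENNReal.ofReal_eq_ofReal_iff (by positivity) (by positivity)] at hsum
  rw [← ENNReal.ofReal_toReal hWA, ← ENNReal.ofReal_toReal hdiff, ← ENNReal.ofReal_toReal hD,
    ← ENNReal.ofReal_mul (by linarith), ← ENNReal.ofReal_add (by positivity) (by positivity),
    ENNReal.ofReal_lt_ofReal_iff_of_nonneg
      (mul_nonneg (by linarith) (by positivity))] at h2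
  rw [← ENNReal.ofReal_toReal hWA, ← ENNReal.ofReal_toReal hAt,
    ← ENNReal.ofReal_mul (by linarith), ENNReal.ofReal_lt_ofReal_iff_of_nonneg
      (mul_nonneg (by linarith) (by positivity))]
  have h3 : e / M * (μ D).toReal ≤ e * (μ A).toReal := by
    rw [div_mul_eq_mul_div, div_le_iff₀ hM0]
    nlinarith
  linarith

/-- The sides of `R` after the dilation of the side in the coordinate `i` by `2 ^ m`. -/
def DyadicRect.trialSide (s : ℕ) (k : Fin t → ℕ) (R : DyadicRect t d) (i : Fin t) (m : ℕ) :
    ∀ r, Set (Fin (d r) → ℝ) :=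
  Function.update (R.expandedSide s k) i
    (Metric.closedBall (dyadicCenter (R.side i)) (2 ^ (m + R.k i - 1)))

theorem measurableSet_pi_trialSide (s : ℕ) (k : Fin t → ℕ) (R : DyadicRect t d) (i : Fin t)
    (m : ℕ) : MeasurableSet (Set.pi Set.univ (R.trialSide s k i m)) := by
  refine MeasurableSet.univ_pi fun r => ?_
  unfold DyadicRect.trialSide
  by_cases h : r = i
  · subst h
    rw [Function.update_self]
    exact measurableSet_closedBall
  · rw [Function.update_of_ne h]
    exact measurableSet_expandedSide _ _ _ _

theorem volume_pi_trialSide (s : ℕ) (k : Fin t → ℕ) (R : DyadicRect t d) (i : Fin t) (m : ℕ) :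
    volume (Set.pi Set.univ (R.trialSide s k i m)) =
      ENNReal.ofReal ((2 ^ (m + R.k i)) ^ d i) *
        ∏ r ∈ Finset.univ.erase i, volume (R.expandedSide s k r) := by
  rw [DyadicRect.trialSide, volume_pi_update, volume_closedBall_two_zpow, sub_add_cancel]

theorem prod_volume_expandedSide_ne_zero (s : ℕ) (k : Fin t → ℕ) (R : DyadicRect t d)
    (F : Finset (Fin t)) : ∏ r ∈ F, volume (R.expandedSide s k r) ≠ 0 :=
  Finset.prod_ne_zero_iff.2 fun r _ => volume_expandedSide_ne_zero s k R r

theorem prod_volume_expandedSide_ne_top (s : ℕ) (k : Fin t → ℕ) (R : DyadicRect t d)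
    (F : Finset (Fin t)) : ∏ r ∈ F, volume (R.expandedSide s k r) ≠ ⊤ :=
  ENNReal.prod_ne_top fun r _ => volume_expandedSide_ne_top s k R r

theorem volume_pi_trialSide_ne_top (s : ℕ) (k : Fin t → ℕ) (R : DyadicRect t d) (i : Fin t)
    (m : ℕ) : volume (Set.pi Set.univ (R.trialSide s k i m)) ≠ ⊤ := by
  rw [volume_pi_trialSide]
  exact ENNReal.mul_ne_top ENNReal.ofReal_ne_top (prod_volume_expandedSide_ne_top _ _ _ _)

/-- There is a largest-type dilation exponent `m`: `W` nearly fills the dilate by `2 ^ m` but not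
the one by `2 ^ (m + 1)`. -/
theorem exists_dilation_exponent (hd : ∀ s, 0 < d s) {e : ℝ} (he : 0 < e) (he1 : e < 1)
    {s : ℕ} {k : Fin t → ℕ} {R : DyadicRect t d} {i : Fin t} (hi : (i : ℕ) = s)
    {W : Set (ProdSpace t d)} (hW : volume W ≠ ⊤)
    (hRW : Set.pi Set.univ (R.expandedSide s k) ⊆ W) :
    ∃ m : ℕ,
      ENNReal.ofReal (1 - e) * volume (Set.pi Set.univ (R.trialSide s k i m)) <
        volume (W ∩ Set.pi Set.univ (R.trialSide s k i m)) ∧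
      volume (W ∩ Set.pi Set.univ (R.trialSide s k i (m + 1))) ≤
        ENNReal.ofReal (1 - e) * volume (Set.pi Set.univ (R.trialSide s k i (m + 1))) := by
  have hside : R.expandedSide s k i = dyadicCube (R.side i) := by
    rw [DyadicRect.expandedSide, if_neg (by lia)]
  set p := ∏ r ∈ Finset.univ.erase i, volume (R.expandedSide s k r) with hp
  have hp0 : p ≠ 0 := prod_volume_expandedSide_ne_zero _ _ _ _
  have hpt : p ≠ ⊤ := prod_volume_expandedSide_ne_top _ _ _ _
  have hzero : ENNReal.ofReal (1 - e) * volume (Set.pi Set.univ (R.trialSide s k i 0)) <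
      volume (W ∩ Set.pi Set.univ (R.trialSide s k i 0)) := by
    have hsub : Set.pi Set.univ (R.expandedSide s k) ⊆
        W ∩ Set.pi Set.univ (R.trialSide s k i 0) := by
      refine Set.subset_inter hRW (Set.pi_mono fun r _ => ?_)
      by_cases h : r = i
      · subst h
        rw [DyadicRect.trialSide, Function.update_self, hside]
        have := dyadicCube_subset_closedBall (R.side r)
        simpa [DyadicRect.side] using this
      · rw [DyadicRect.trialSide, Function.update_of_ne h]
    have hvol : volume (Set.pi Set.univ (R.trialSide s k i 0)) =
        volume (Set.pi Set.univ (R.expandedSide s k)) := by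
      rw [volume_pi_trialSide, volume_pi_eq_mul_prod_erase _ i, hside, volume_dyadicCube]
      simp [DyadicRect.side]
    refine lt_of_lt_of_le ?_ (measure_mono hsub)
    rw [hvol]
    have h0 : volume (Set.pi Set.univ (R.expandedSide s k)) ≠ 0 := by
      rw [volume_pi, Measure.pi_pi]
      exact prod_volume_expandedSide_ne_zero _ _ _ _
    have htop : volume (Set.pi Set.univ (R.expandedSide s k)) ≠ ⊤ := by
      rw [volume_pi, Measure.pi_pi]
      exact prod_volume_expandedSide_ne_top _ _ _ _
    calc _ < 1 * volume (Set.pi Set.univ (R.expandedSide s k)) := by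
          refine ENNReal.mul_lt_mul_left h0 htop ?_
          rw [ENNReal.ofReal_lt_one]
          linarith
      _ = _ := one_mul _
  have hex : ∃ m, volume (W ∩ Set.pi Set.univ (R.trialSide s k i (m + 1))) ≤
      ENNReal.ofReal (1 - e) * volume (Set.pi Set.univ (R.trialSide s k i (m + 1))) := by
    by_contra! hall
    have he' : ENNReal.ofReal (1 - e) ≠ 0 := by simpa using he1
    obtain ⟨B, hB⟩ := exists_scale_bound (hd i) (v := volume W / (ENNReal.ofReal (1 - e) * p))
      (ENNReal.div_ne_top hW (mul_ne_zero he' hp0))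
    have := hB (((B - R.k i).toNat + 1 : ℕ) + R.k i) (by
      rw [ENNReal.le_div_iff_mul_le (Or.inl (mul_ne_zero he' hp0))
        (Or.inl (ENNReal.mul_ne_top ENNReal.ofReal_ne_top hpt))]
      have h := (hall (B - R.k i).toNat).le.trans (measure_mono Set.inter_subset_left)
      rw [volume_pi_trialSide, ← hp] at h
      rwa [mul_left_comm])
    lia
  refine ⟨Nat.find hex, ?_, Nat.find_spec hex⟩
  rcases Nat.eq_zero_or_pos (Nat.find hex) with h | h
  · rw [h]
    exact hzero
  · have := Nat.find_min hex (m := Nat.find hex - 1) (by lia)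
    rw [Nat.sub_add_cancel h] at this
    exact not_le.1 this

theorem mixedBasis_of_lt {s : ℕ} {r : Fin t} (h : (r : ℕ) < s) (j : ℤ) (x : Fin (d r) → ℝ) :
    mixedBasis d s r j x = Metric.closedBall x (2 ^ j) := by
  rw [mixedBasis, if_pos h, ballBasis]

theorem mixedBasis_of_mem_dyadicCube {s : ℕ} {r : Fin t} (h : ¬(r : ℕ) < s)
    {Q : ℤ × (Fin (d r) → ℤ)} {x : Fin (d r) → ℝ} (hx : x ∈ dyadicCube Q) :
    mixedBasis d s r Q.1 x = dyadicCube Q := by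
  rw [mixedBasis, if_neg h, dyadicBasis]
  have : dyadicIndex Q.1 x = Q.2 := hx
  rw [this]

theorem measurableSet_mixedBasis (s : ℕ) (r : Fin t) (j : ℤ) (x : Fin (d r) → ℝ) :
    MeasurableSet (mixedBasis d s r j x) := by
  unfold mixedBasis
  split_ifs
  · exact measurableSet_closedBall
  · exact measurableSet_dyadicCube _

theorem volume_closedBall_two_zpow_le {n : ℕ} (x y : Fin n → ℝ) {j j' : ℤ} (m : ℕ)
    (h : j' ≤ j + m) :
    volume (Metric.closedBall x (2 ^ j')) ≤
      ENNReal.ofReal ((2 ^ m) ^ n) * volume (Metric.closedBall y ((2 : ℝ) ^ j)) := by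
  rw [volume_closedBall_two_zpow, volume_closedBall_two_zpow, ← ENNReal.ofReal_mul (by positivity),
    ← mul_pow]
  refine ENNReal.ofReal_le_ofReal ?_
  gcongr
  rw [← zpow_natCast, ← zpow_add₀ (by norm_num)]
  exact zpow_le_zpow_right₀ (by norm_num) (by lia)

theorem volume_pi_le_of_forall_le {ι : Type*} [Fintype ι] {Y : ι → Type*}
    [∀ i, MeasureSpace (Y i)] [∀ i, SigmaFinite (volume : Measure (Y i))]
    {A B : ∀ i, Set (Y i)} {M : ι → ℝ} (hM : ∀ i, 0 ≤ M i)
    (h : ∀ i, volume (A i) ≤ ENNReal.ofReal (M i) * volume (B i)) :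
    volume (Set.pi Set.univ A) ≤ ENNReal.ofReal (∏ i, M i) * volume (Set.pi Set.univ B) := by
  rw [volume_pi, Measure.pi_pi, Measure.pi_pi, ENNReal.ofReal_prod_of_nonneg fun i _ => hM i,
    ← Finset.prod_mul_distrib]
  exact Finset.prod_le_prod' fun i _ => h i

theorem one_le_prod_two_pow (m : ℕ) : (1 : ℝ) ≤ ∏ r, (2 ^ m) ^ d r :=
  Finset.prod_induction _ (1 ≤ ·) (fun _ _ => one_le_mul_of_one_le_of_one_le) le_rfl
    fun _ _ => one_le_pow₀ (one_le_pow₀ (by norm_num))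

theorem exists_mixedBasis_subset_trialSide {s : ℕ} {k : Fin t → ℕ} {R : DyadicRect t d}
    {i : Fin t} (hi : (i : ℕ) = s) {m : ℕ} (r : Fin t) {x : Fin (d r) → ℝ}
    (hx : x ∈ R.expandedSide (s + 1) (Function.update k i m) r) :
    ∃ j, mixedBasis d (s + 1) r j x ⊆ R.trialSide s k i m r ∧
      volume (R.trialSide s k i m r) ≤
        ENNReal.ofReal ((2 ^ 1) ^ d r) * volume (mixedBasis d (s + 1) r j x) := by
  by_cases hr : (r : ℕ) < s + 1
  · rw [DyadicRect.expandedSide, if_pos hr] at hx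
    set ρ : ℤ := Function.update k i m r + R.k r - 1 - (((s + 1 : ℕ) : ℤ) - r) with hρ
    have htr : R.trialSide s k i m r =
        Metric.closedBall (dyadicCenter (R.side r)) (2 ^ (ρ + 1)) := by
      by_cases h : r = i
      · subst h
        rw [DyadicRect.trialSide, Function.update_self]
        rw [Function.update_self] at hρ
        congr 2
        lia
      · rw [DyadicRect.trialSide, Function.update_of_ne h, DyadicRect.expandedSide, if_pos]
        · rw [Function.update_of_ne h] at hρ
          congr 2
          lia
        · have : (r : ℕ) ≠ i := fun h' => h (Fin.ext h')
          lia
    refine ⟨ρ, ?_, ?_⟩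
    · rw [mixedBasis_of_lt hr, htr]
      refine Metric.closedBall_subset_closedBall' ?_
      rw [Metric.mem_closedBall] at hx
      rw [zpow_add₀ (by norm_num), zpow_one]
      linarith
    · rw [mixedBasis_of_lt hr, htr]
      exact volume_closedBall_two_zpow_le _ _ 1 le_rfl
  · rw [DyadicRect.expandedSide, if_neg hr] at hx
    have h : r ≠ i := by rintro rfl; lia
    refine ⟨R.k r, ?_⟩
    have hb : mixedBasis d (s + 1) r (R.k r) x = dyadicCube (R.side r) :=
      mixedBasis_of_mem_dyadicCube hr hx
    rw [hb, DyadicRect.trialSide, Function.update_of_ne h, DyadicRect.expandedSide,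
      if_neg (by lia)]
    refine ⟨subset_rfl, le_mul_of_one_le_left zero_le ?_⟩
    rw [ENNReal.one_le_ofReal]
    exact one_le_pow₀ (by norm_num)

/-- If `W` nearly fills the dilate of `R` in the next coordinate, the shrunken dilate lies in the
halo of `W`. -/
theorem pi_expandedSide_subset_mixedHalo {l : ℝ} (hl : 0 < l) (hl1 : l < 1) {N : ℕ} {s : ℕ}
    (hb : ∀ r, IsHaloBasis N (mixedBasis d (s + 1) r)) {k : Fin t → ℕ} {R : DyadicRect t d}
    {i : Fin t} (hi : (i : ℕ) = s) {m : ℕ} {W : Set (ProdSpace t d)} (hW : MeasurableSet W)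
    (h : ENNReal.ofReal (1 - (1 - l) ^ t / ∏ r, (2 ^ 1) ^ d r) *
        volume (Set.pi Set.univ (R.trialSide s k i m)) <
      volume (W ∩ Set.pi Set.univ (R.trialSide s k i m))) :
    Set.pi Set.univ (R.expandedSide (s + 1) (Function.update k i m)) ⊆
      mixedHalo l (s + 1) W := by
  intro x hx
  choose j hj hjv using fun r => exists_mixedBasis_subset_trialSide hi r (hx r (Set.mem_univ r))
  refine mem_iteratedHalo_of_density hl hl1 hb hW x j ?_
  rw [Fintype.card_fin]
  exact density_of_subset (MeasurableSet.univ_pi fun r => measurableSet_mixedBasis _ _ _ _)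
    (Set.pi_mono fun r _ => hj r) (volume_pi_trialSide_ne_top _ _ _ _ _)
    (pow_nonneg (by linarith) _) (pow_le_one₀ (by linarith) (by linarith))
    (one_le_prod_two_pow 1)
    (volume_pi_le_of_forall_le (fun r => by positivity) hjv) h

theorem exists_expandedSide_subset_mixedBasis {s : ℕ} (hs : s ≤ t) {k : Fin t → ℕ}
    {R : DyadicRect t d} (r : Fin t) {x : Fin (d r) → ℝ} (hx : x ∈ dyadicCube (R.side r)) :
    ∃ j, R.expandedSide s k r ⊆ mixedBasis d s r j x ∧
      volume (mixedBasis d s r j x) ≤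
        ENNReal.ofReal ((2 ^ (t + 1)) ^ d r) * volume (R.expandedSide s k r) := by
  by_cases hr : (r : ℕ) < s
  · rw [DyadicRect.expandedSide, if_pos hr]
    set ρ : ℤ := k r + R.k r - 1 - ((s : ℤ) - r) with hρ
    refine ⟨ρ + ((t + 1 : ℕ) : ℤ), ?_, ?_⟩
    · rw [mixedBasis_of_lt hr]
      refine Metric.closedBall_subset_closedBall' ?_
      have hx' := dyadicCube_subset_closedBall _ hx
      rw [Metric.mem_closedBall, dist_comm] at hx'
      have h1 : (2 : ℝ) ^ ((R.side r).1 - 1) ≤ 2 ^ (ρ + t) :=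
        zpow_le_zpow_right₀ (by norm_num) (by simp only [DyadicRect.side]; lia)
      have h2 : (2 : ℝ) ^ ρ ≤ 2 ^ (ρ + t) := zpow_le_zpow_right₀ (by norm_num) (by lia)
      have h3 : (2 : ℝ) ^ (ρ + ((t + 1 : ℕ) : ℤ)) = 2 * 2 ^ (ρ + t) := by
        rw [Nat.cast_succ, ← add_assoc, zpow_add₀ (by norm_num), zpow_one, mul_comm]
      linarith
    · rw [mixedBasis_of_lt hr]
      exact volume_closedBall_two_zpow_le _ _ (t + 1) le_rfl
  · have hb : mixedBasis d s r (R.k r) x = dyadicCube (R.side r) :=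
      mixedBasis_of_mem_dyadicCube hr hx
    refine ⟨R.k r, ?_⟩
    rw [hb, DyadicRect.expandedSide, if_neg hr]
    refine ⟨subset_rfl, le_mul_of_one_le_left zero_le ?_⟩
    rw [ENNReal.one_le_ofReal]
    exact one_le_pow₀ (one_le_pow₀ (by norm_num))

/-- If `E` has a fixed proportion of the dilate of `R`, then `R` lies in a halo of `E`. -/
theorem box_subset_mixedHalo {l : ℝ} (hl : 0 < l) (hl1 : l < 1) {N : ℕ} {s : ℕ} (hs : s ≤ t)
    (hb : ∀ r, IsHaloBasis N (mixedBasis d s r)) {k : Fin t → ℕ} {R : DyadicRect t d}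
    {e : ℝ} (hle : 1 - (1 - l) ^ t < e / ∏ r, (2 ^ (t + 1)) ^ d r) {E : Set (ProdSpace t d)}
    (hE : MeasurableSet E)
    (h : ENNReal.ofReal e * volume (Set.pi Set.univ (R.expandedSide s k)) ≤
      volume (E ∩ Set.pi Set.univ (R.expandedSide s k))) :
    R.box ⊆ mixedHalo l s E := by
  intro x hx
  choose j hj hjv using fun r =>
    exists_expandedSide_subset_mixedBasis (k := k) hs r (hx r (Set.mem_univ r))
  refine mem_iteratedHalo_of_density hl hl1 hb hE x j ?_
  set P := Set.pi Set.univ fun r => mixedBasis d s r (j r) (x r)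
  set B := Set.pi Set.univ (R.expandedSide s k) with hB
  have hBP : B ⊆ P := Set.pi_mono fun r _ => hj r
  have hPB : volume P ≤ ENNReal.ofReal (∏ r, (2 ^ (t + 1)) ^ d r) * volume B :=
    volume_pi_le_of_forall_le (fun r => by positivity) hjv
  have hM := one_le_prod_two_pow (d := d) (t + 1)
  set M : ℝ := ∏ r, (2 ^ (t + 1)) ^ d r
  have hB0 : volume B ≠ 0 := by
    rw [hB, volume_pi, Measure.pi_pi]
    exact prod_volume_expandedSide_ne_zero _ _ _ _
  have hBt : volume B ≠ ⊤ := by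
    rw [hB, volume_pi, Measure.pi_pi]
    exact prod_volume_expandedSide_ne_top _ _ _ _
  have hM0 : 0 < M := by linarith
  have hl0 : 0 ≤ 1 - (1 - l) ^ t := by
    have : (1 - l) ^ t ≤ 1 := pow_le_one₀ (by linarith) (by linarith)
    linarith
  have hlM : (1 - (1 - l) ^ t) * M < e := (lt_div_iff₀ hM0).1 hle
  rw [Fintype.card_fin]
  calc _ ≤ ENNReal.ofReal (1 - (1 - l) ^ t) * (ENNReal.ofReal M * volume B) := by gcongr
    _ = ENNReal.ofReal ((1 - (1 - l) ^ t) * M) * volume B := by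
        rw [ENNReal.ofReal_mul hl0, mul_assoc]
    _ < ENNReal.ofReal e * volume B := by
        refine ENNReal.mul_lt_mul_left hB0 hBt ?_
        exact (ENNReal.ofReal_lt_ofReal_iff_of_nonneg (by positivity)).2 hlM
    _ ≤ volume (E ∩ B) := h
    _ ≤ volume (E ∩ P) := measure_mono (Set.inter_subset_inter_right _ hBP)

/-- The union of the cylinders over the sides, in the coordinates other than `i`, of the dilates
of the rectangles of a collection. -/
def cylinderUnion (s : ℕ) (k : DyadicRect t d → Fin t → ℕ) (i : Fin t)
    (𝒮 : Set (DyadicRect t d)) : Set (ProdSpace t d) :=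
  ⋃ R ∈ 𝒮, {x | ∀ r, r ≠ i → x r ∈ R.expandedSide s (k R) r}

/-- The part of `cylinderUnion s k i (𝒮 Q)` outside the cylinders belonging to the cubes which
contain the dilate of `Q` by `2 ^ (n + 1)`. -/
def escapeSet (s : ℕ) (k : DyadicRect t d → Fin t → ℕ) (i : Fin t) (n : ℕ)
    (𝒮 : ℤ × (Fin (d i) → ℤ) → Set (DyadicRect t d)) (Q : ℤ × (Fin (d i) → ℤ)) :
    Set (ProdSpace t d) :=
  cylinderUnion s k i (𝒮 Q) \
    ⋃ Q' ∈ {Q' | Metric.closedBall (dyadicCenter Q) (2 ^ (n + Q.1)) ⊆ dyadicCube Q'},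
      cylinderUnion s k i (𝒮 Q')

section Escape

variable {s : ℕ} {k : DyadicRect t d → Fin t → ℕ} {i : Fin t}

theorem measurableSet_cylinderUnion (𝒮 : Set (DyadicRect t d)) :
    MeasurableSet (cylinderUnion s k i 𝒮) := by
  refine MeasurableSet.biUnion (Set.to_countable _) fun R _ => ?_
  simp only [Set.ofPred_forall]
  exact MeasurableSet.iInter fun r => MeasurableSet.iInter fun _ =>
    (measurableSet_expandedSide s (k R) R r).preimage (measurable_pi_apply r)

theorem update_mem_cylinderUnion {𝒮 : Set (DyadicRect t d)} {x : ProdSpace t d}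
    {y : Fin (d i) → ℝ} :
    Function.update x i y ∈ cylinderUnion s k i 𝒮 ↔ x ∈ cylinderUnion s k i 𝒮 := by
  simp only [cylinderUnion, Set.mem_iUnion, Set.mem_ofPred_eq]
  refine exists_congr fun R => exists_congr fun _ => forall_congr' fun r => ?_
  refine forall_congr' fun hr => ?_
  rw [Function.update_of_ne hr]

variable {n : ℕ} {𝒮 : ℤ × (Fin (d i) → ℤ) → Set (DyadicRect t d)}

theorem measurableSet_escapeSet (Q : ℤ × (Fin (d i) → ℤ)) :
    MeasurableSet (escapeSet s k i n 𝒮 Q) :=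
  (measurableSet_cylinderUnion _).diff
    (MeasurableSet.biUnion (Set.to_countable _) fun _ _ => measurableSet_cylinderUnion _)

theorem update_mem_escapeSet {Q : ℤ × (Fin (d i) → ℤ)} {x : ProdSpace t d} {y : Fin (d i) → ℝ} :
    Function.update x i y ∈ escapeSet s k i n 𝒮 Q ↔ x ∈ escapeSet s k i n 𝒮 Q := by
  simp only [escapeSet, Set.mem_sdiff, Set.mem_iUnion, update_mem_cylinderUnion]

theorem measurableSet_escapeSet_inter (Q : ℤ × (Fin (d i) → ℤ)) :
    MeasurableSet (escapeSet s k i n 𝒮 Q ∩ {x | x i ∈ dyadicCube Q}) :=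
  (measurableSet_escapeSet Q).inter
    ((measurableSet_dyadicCube Q).preimage (measurable_pi_apply i))

theorem mem_pi_expandedSide_of_mem (hi : (i : ℕ) = s) {R : DyadicRect t d} {x : ProdSpace t d}
    (hx : ∀ r, r ≠ i → x r ∈ R.expandedSide s (k R) r) (hxi : x i ∈ dyadicCube (R.side i)) :
    x ∈ Set.pi Set.univ (R.expandedSide s (k R)) := by
  intro r _
  by_cases h : r = i
  · subst h
    rwa [DyadicRect.expandedSide, if_neg (by lia)]
  · exact hx r h

variable (h𝒮 : ∀ Q, ∀ R ∈ 𝒮 Q, R.side i = Q) {W : Set (ProdSpace t d)}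
  (hkW : ∀ Q, ∀ R ∈ 𝒮 Q, Set.pi Set.univ (R.expandedSide s (k R)) ⊆ W) (hi : (i : ℕ) = s)

include h𝒮 hkW hi

theorem tsum_volume_escapeSet_le (hd : 0 < d i) (hW : MeasurableSet W) :
    ∑' Q, volume (escapeSet s k i n 𝒮 Q ∩ {x | x i ∈ dyadicCube Q}) ≤
      ENNReal.ofReal (d i * 2 ^ (n + 3)) * volume W := by
  have hm : ∀ Q, Measurable ((escapeSet s k i n 𝒮 Q ∩
      {x | x i ∈ dyadicCube Q}).indicator (1 : ProdSpace t d → ℝ≥0∞)) := fun Q =>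
    measurable_one.indicator (measurableSet_escapeSet_inter Q)
  have key : ∫⁻ x, ∑' Q, (escapeSet s k i n 𝒮 Q ∩
      {x | x i ∈ dyadicCube Q}).indicator (1 : ProdSpace t d → ℝ≥0∞) x ≤
      ∫⁻ x, ENNReal.ofReal (d i * 2 ^ (n + 3)) * W.indicator 1 x := by
    refine lintegral_le_of_lintegral_update_le (Measurable.tsum hm)
      ((measurable_one.indicator hW).const_mul _) i fun x => ?_
    have h1 : ∀ F : Set (ProdSpace t d), MeasurableSet F →
        ∫⁻ y, F.indicator (1 : ProdSpace t d → ℝ≥0∞) (Function.update x i y) =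
          volume {y | Function.update x i y ∈ F} := fun F hF =>
      lintegral_indicator_one (measurableSet_slice hF i x)
    rw [lintegral_const_mul _ (f := fun y => W.indicator (1 : ProdSpace t d → ℝ≥0∞)
        (Function.update x i y)) ((measurable_one.indicator hW).comp (measurable_update x)), h1 W hW,
      lintegral_tsum (f := fun Q y => (escapeSet s k i n 𝒮 Q ∩ {x | x i ∈ dyadicCube Q}).indicator
        (1 : ProdSpace t d → ℝ≥0∞) (Function.update x i y))
        fun Q => ((hm Q).comp (measurable_update x)).aemeasurable]
    simp only [h1 _ (measurableSet_escapeSet_inter _)]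
    set T := {Q | x ∈ escapeSet s k i n 𝒮 Q} with hT
    have hsl : ∀ Q, volume {y | Function.update x i y ∈
        escapeSet s k i n 𝒮 Q ∩ {x | x i ∈ dyadicCube Q}} =
        T.indicator (fun Q => volume (dyadicCube Q)) Q := by
      intro Q
      simp only [Set.mem_inter_iff, update_mem_escapeSet, Set.mem_ofPred_eq, Function.update_self]
      by_cases hQ : x ∈ escapeSet s k i n 𝒮 Q
      · rw [Set.indicator_of_mem (by exact hQ)]
        simp [hQ]
      · rw [Set.indicator_of_notMem (by exact hQ)]
        simp [hQ]
    simp only [hsl]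
    rw [← tsum_subtype T fun Q => volume (dyadicCube Q)]
    refine (tsum_volume_dyadicCube_le hd n T ?_).trans ?_
    · intro Q hQ Q' hQ' hsub
      exact hQ.2 (Set.mem_biUnion (by exact hsub) hQ'.1)
    · gcongr
      refine Set.iUnion₂_subset fun Q hQ y hy => ?_
      obtain ⟨R, hR, hxR⟩ := Set.mem_iUnion₂.1 hQ.1
      refine hkW Q R hR (mem_pi_expandedSide_of_mem hi (fun r hr => ?_) ?_)
      · rw [Function.update_of_ne hr]
        exact hxR r hr
      · rw [Function.update_self, h𝒮 Q R hR]
        exact hy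
  rwa [lintegral_const_mul _ (measurable_one.indicator hW), lintegral_indicator_one hW,
    lintegral_tsum fun Q => (hm Q).aemeasurable,
    tsum_congr fun Q => lintegral_indicator_one (measurableSet_escapeSet_inter Q)] at key

theorem volume_escapeSet_inter_ge {e : ℝ} (he : 0 ≤ e) (he1 : e ≤ 1) {Q : ℤ × (Fin (d i) → ℤ)}
    {R : DyadicRect t d} (hW : MeasurableSet W) (hR : R ∈ 𝒮 Q)
    (hRW : volume (W ∩ Set.pi Set.univ (R.trialSide s (k R) i (n + 1))) ≤
        ENNReal.ofReal (1 - e) * volume (Set.pi Set.univ (R.trialSide s (k R) i (n + 1)))) :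
    ENNReal.ofReal e * volume (Set.pi Set.univ (R.expandedSide s (k R))) ≤
      volume (escapeSet s k i n 𝒮 Q ∩ {x | x i ∈ dyadicCube Q} ∩
        Set.pi Set.univ (R.expandedSide s (k R))) := by
  have hside := h𝒮 Q R hR
  have hk : R.k i = Q.1 := congrArg Prod.fst hside
  set D := Set.pi Set.univ (R.trialSide s (k R) i (n + 1)) with hD
  set B := Set.pi Set.univ (R.expandedSide s (k R)) with hB
  have hDt : volume D ≠ ⊤ := volume_pi_trialSide_ne_top _ _ _ _ _
  have hmemD : ∀ x, x ∈ D ↔ (∀ r, r ≠ i → x r ∈ R.expandedSide s (k R) r) ∧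
      x i ∈ Metric.closedBall (dyadicCenter Q) (2 ^ (n + Q.1)) := by
    intro x
    have hball : R.trialSide s (k R) i (n + 1) i =
        Metric.closedBall (dyadicCenter Q) (2 ^ (n + Q.1)) := by
      rw [DyadicRect.trialSide, Function.update_self, hside, hk]
      congr 2
      push_cast
      ring
    constructor
    · intro hx
      refine ⟨fun r hr => ?_, ?_⟩
      · have := hx r (Set.mem_univ r)
        rwa [DyadicRect.trialSide, Function.update_of_ne hr] at this
      · rw [← hball]
        exact hx i (Set.mem_univ i)
    · rintro ⟨h1, h2⟩ r -
      by_cases hr : r = i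
      · subst hr
        rwa [hball]
      · rw [DyadicRect.trialSide, Function.update_of_ne hr]
        exact h1 r hr
  have hDE : D \ W ⊆ escapeSet s k i n 𝒮 Q ∩ D := by
    rintro x ⟨hxD, hxW⟩
    obtain ⟨h1, h2⟩ := (hmemD x).1 hxD
    refine ⟨⟨Set.mem_biUnion hR h1, fun hx => ?_⟩, hxD⟩
    obtain ⟨Q', hQ', hx⟩ := Set.mem_iUnion₂.1 hx
    obtain ⟨R', hR', hx⟩ := Set.mem_iUnion₂.1 hx
    refine hxW (hkW Q' R' hR' (mem_pi_expandedSide_of_mem hi hx ?_))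
    rw [h𝒮 Q' R' hR']
    exact hQ' h2
  have heD : ENNReal.ofReal e * volume D ≤ volume (D \ W) := by
    have h1 : volume D ≤ ENNReal.ofReal (1 - e) * volume D + volume (D \ W) := by
      refine (measure_inter_add_sdiff D hW).symm.le.trans ?_
      rw [Set.inter_comm]
      gcongr
    have h2 : volume D = ENNReal.ofReal (1 - e) * volume D + ENNReal.ofReal e * volume D := by
      rw [← add_mul, ← ENNReal.ofReal_add (by linarith) he, sub_add_cancel, ENNReal.ofReal_one,
        one_mul]
    nth_rewrite 1 [h2] at h1
    exact (ENNReal.add_le_add_iff_left (ENNReal.mul_ne_top ENNReal.ofReal_ne_top hDt)).1 h1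
  set c : ℝ≥0∞ := ENNReal.ofReal ((2 ^ (n + 1)) ^ d i) with hc
  have hc0 : c ≠ 0 := by
    simp only [hc, ne_eq, ENNReal.ofReal_eq_zero, not_le]
    positivity
  have hball : volume (Metric.closedBall (dyadicCenter Q) (2 ^ (n + Q.1))) =
      c * volume (dyadicCube Q) := by
    rw [volume_closedBall_two_zpow, volume_dyadicCube, hc, ← ENNReal.ofReal_mul (by positivity),
      ← mul_pow, ← zpow_natCast (2 : ℝ) (n + 1), ← zpow_add₀ (by norm_num)]
    congr 3
    push_cast
    ring
  have hDB : volume D = c * volume B := by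
    have hBi : R.expandedSide s (k R) i = dyadicCube Q := by
      rw [DyadicRect.expandedSide, if_neg (by lia), hside]
    rw [hD, volume_pi_trialSide, hB, volume_pi_eq_mul_prod_erase (R.expandedSide s (k R)) i, hBi,
      ← mul_assoc, ← hball, volume_closedBall_two_zpow, hk]
    congr 4
    push_cast
    ring
  have hcyl : volume (escapeSet s k i n 𝒮 Q ∩ D) ≤
      c * volume (escapeSet s k i n 𝒮 Q ∩ {x | x i ∈ dyadicCube Q} ∩ B) := by
    refine volume_le_of_volume_slice_le
      ((measurableSet_escapeSet Q).inter (measurableSet_pi_trialSide _ _ _ _ _))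
      ((measurableSet_escapeSet_inter Q).inter
        (MeasurableSet.univ_pi fun r => measurableSet_expandedSide _ _ _ r)) i c fun x => ?_
    by_cases hx : x ∈ escapeSet s k i n 𝒮 Q ∧ ∀ r, r ≠ i → x r ∈ R.expandedSide s (k R) r
    · calc _ ≤ volume (Metric.closedBall (dyadicCenter Q) ((2 : ℝ) ^ (n + Q.1))) := by
            refine measure_mono fun y hy => ?_
            have := ((hmemD _).1 hy.2).2
            rwa [Function.update_self] at this
        _ = c * volume (dyadicCube Q) := hball
        _ ≤ _ := by
            gcongr
            intro y hy
            refine ⟨⟨update_mem_escapeSet.2 hx.1, ?_⟩, mem_pi_expandedSide_of_mem hi ?_ ?_⟩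
            · simpa using hy
            · intro r hr
              rw [Function.update_of_ne hr]
              exact hx.2 r hr
            · rw [Function.update_self, hside]
              exact hy
    · have : {y | Function.update x i y ∈ escapeSet s k i n 𝒮 Q ∩ D} = ∅ := by
        refine Set.eq_empty_of_forall_notMem fun y hy => hx ⟨update_mem_escapeSet.1 hy.1, ?_⟩
        intro r hr
        have := ((hmemD _).1 hy.2).1 r hr
        rwa [Function.update_of_ne hr] at this
      rw [this, measure_empty]
      exact zero_le
  have := heD.trans ((measure_mono hDE).trans hcyl)
  rw [hDB, mul_left_comm] at this
  exact (ENNReal.mul_le_mul_iff_right hc0 ENNReal.ofReal_ne_top).1 this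

/-- The shadows of the subcollections with a common side in the coordinate `i` and dilation
exponent `n` have total measure at most a multiple of `2 ^ n`. -/
theorem tsum_volume_biUnion_box_le (hd : 0 < d i) (hW : MeasurableSet W) {l e : ℝ} (hl : 0 < l)
    (hl1 : l < 1) {N : ℕ} (hb : ∀ r, IsHaloBasis N (mixedBasis d s r)) (he : 0 ≤ e) (he1 : e ≤ 1)
    (hle : 1 - (1 - l) ^ t < e / ∏ r, (2 ^ (t + 1)) ^ d r)
    (hRW : ∀ Q, ∀ R ∈ 𝒮 Q, volume (W ∩ Set.pi Set.univ (R.trialSide s (k R) i (n + 1))) ≤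
        ENNReal.ofReal (1 - e) * volume (Set.pi Set.univ (R.trialSide s (k R) i (n + 1)))) :
    ∑' Q, volume (⋃ R ∈ 𝒮 Q, R.box) ≤
      ENNReal.ofReal (1 + N * ((1 - l) / l)) ^ t * (ENNReal.ofReal (d i * 2 ^ (n + 3)) *
        volume W) := by
  calc _ ≤ ∑' Q, ENNReal.ofReal (1 + N * ((1 - l) / l)) ^ t *
        volume (escapeSet s k i n 𝒮 Q ∩ {x | x i ∈ dyadicCube Q}) := by
        refine ENNReal.tsum_le_tsum fun Q => ?_
        refine le_trans (measure_mono ?_)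
          (volume_mixedHalo_le hl hl1 hb (measurableSet_escapeSet_inter Q))
        refine Set.iUnion₂_subset fun R hR => ?_
        exact box_subset_mixedHalo hl hl1 (hi ▸ i.2.le) hb hle (measurableSet_escapeSet_inter Q)
          (volume_escapeSet_inter_ge h𝒮 hkW hi he he1 hW hR (hRW Q R hR))
    _ ≤ _ := by
        rw [ENNReal.tsum_mul_left]
        gcongr
        exact tsum_volume_escapeSet_le h𝒮 hkW hi hd hW

end Escape

/-- The halos of `E` for the bases `mixedBasis d 1, …, mixedBasis d s`, taken successively. -/
def haloSeq (l : ℝ) (E : Set (ProdSpace t d)) : ℕ → Set (ProdSpace t d)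
  | 0 => E
  | s + 1 => mixedHalo l (s + 1) (haloSeq l E s)

theorem subset_haloSeq (l : ℝ) (E : Set (ProdSpace t d)) (s : ℕ) : E ⊆ haloSeq l E s := by
  induction s with
  | zero => exact subset_rfl
  | succ s ih => exact ih.trans (subset_iteratedHalo _ _ _ _)

theorem haloSeq_mono (l : ℝ) {E F : Set (ProdSpace t d)} (h : E ⊆ F) (s : ℕ) :
    haloSeq l E s ⊆ haloSeq l F s := by
  induction s with
  | zero => exact h
  | succ s ih => exact iteratedHalo_mono _ _ _ ih

theorem measurableSet_haloSeq {N : ℕ} (hb : ∀ s r, IsHaloBasis N (mixedBasis d s r)) (l : ℝ)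
    {E : Set (ProdSpace t d)} (hE : MeasurableSet E) (s : ℕ) : MeasurableSet (haloSeq l E s) := by
  induction s with
  | zero => exact hE
  | succ s ih => exact measurableSet_iteratedHalo (hb (s + 1)) _ ih

theorem volume_haloSeq_le {N : ℕ} (hb : ∀ s r, IsHaloBasis N (mixedBasis d s r)) {l : ℝ}
    (hl : 0 < l) (hl1 : l < 1) {E : Set (ProdSpace t d)} (hE : MeasurableSet E) (s : ℕ) :
    volume (haloSeq l E s) ≤
      (ENNReal.ofReal (1 + N * ((1 - l) / l)) ^ t) ^ s * volume E := by
  induction s with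
  | zero => simp [haloSeq]
  | succ s ih =>
    refine (volume_mixedHalo_le hl hl1 (hb (s + 1)) (measurableSet_haloSeq hb l hE s)).trans ?_
    rw [pow_succ', mul_assoc]
    gcongr

theorem measurableSet_biUnion_box (𝒰 : Set (DyadicRect t d)) :
    MeasurableSet (⋃ R ∈ 𝒰, R.box) :=
  MeasurableSet.biUnion (Set.to_countable _) fun _ _ =>
    MeasurableSet.univ_pi fun _ => measurableSet_dyadicCube _

theorem exists_one_sub_one_sub_pow_lt (n : ℕ) {δ : ℝ} (hδ : 0 < δ) :
    ∃ l : ℝ, 0 < l ∧ l < 1 ∧ 1 - (1 - l) ^ n < δ := by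
  have hc : Filter.Tendsto (fun l : ℝ => 1 - (1 - l) ^ n) (nhdsWithin 0 (Set.Ioi 0))
      (nhds 0) := by
    have : Continuous fun l : ℝ => 1 - (1 - l) ^ n := by fun_prop
    simpa using (this.tendsto 0).mono_left nhdsWithin_le_nhds
  obtain ⟨l, h1, h2⟩ := ((hc.eventually_lt_const hδ).and
    (Ioo_mem_nhdsGT (zero_lt_one' ℝ))).exists
  exact ⟨l, h2.1, h2.2, h1⟩

/-- Each rectangle of a collection can be dilated, in the first `s` coordinates successively, within
the halo of the shadow, in such a way that the dilation exponents are controlled. -/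
theorem exists_dilation_exponents (hd : ∀ s, 0 < d s) {N : ℕ}
    (hb : ∀ s r, IsHaloBasis N (mixedBasis d s r)) {l : ℝ} (hl : 0 < l) (hl1 : l < 1) (s : ℕ)
    (hs : s ≤ t) :
    ∃ C : ℝ≥0∞, C ≠ ⊤ ∧ ∀ 𝒰 : Set (DyadicRect t d), volume (⋃ R ∈ 𝒰, R.box) ≠ ⊤ →
      ∃ k : DyadicRect t d → Fin t → ℕ,
        (∀ R ∈ 𝒰, Set.pi Set.univ (R.expandedSide s (k R)) ⊆
          haloSeq l (⋃ R ∈ 𝒰, R.box) s) ∧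
        ∀ r : Fin t, (r : ℕ) < s → ∀ n,
          ∑' Q, volume (⋃ R ∈ {R | R ∈ 𝒰 ∧ k R r = n ∧ R.side r = Q}, R.box) ≤
            C * 2 ^ n * volume (⋃ R ∈ 𝒰, R.box) := by
  induction s with
  | zero =>
    refine ⟨0, ENNReal.zero_ne_top, fun 𝒰 _ => ⟨fun _ _ => 0, fun R hR => ?_, fun r hr => ?_⟩⟩
    · refine Set.Subset.trans ?_ (Set.subset_biUnion_of_mem hR)
      exact Set.pi_mono fun r _ => by rw [DyadicRect.expandedSide, if_neg (Nat.not_lt_zero _)]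
    · exact absurd hr (Nat.not_lt_zero _)
  | succ s ih =>
    obtain ⟨C, hC, hall⟩ := ih (by lia)
    set i : Fin t := ⟨s, by lia⟩ with hi
    have his : (i : ℕ) = s := rfl
    have hM := one_le_prod_two_pow (d := d) 1
    have hM' := one_le_prod_two_pow (d := d) (t + 1)
    set e : ℝ := (1 - l) ^ t / ∏ r, (2 ^ 1) ^ d r with he
    have he0 : 0 < e := div_pos (pow_pos (by linarith) _) (by linarith)
    have he1 : e < 1 := by
      rw [he, div_lt_one (by linarith)]
      exact (pow_lt_one₀ (by linarith) (by linarith) (by lia)).trans_le hM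
    obtain ⟨l', hl', hl1', hle⟩ := exists_one_sub_one_sub_pow_lt t
      (δ := e / ∏ r, (2 ^ (t + 1)) ^ d r) (div_pos he0 (by linarith))
    set c := (ENNReal.ofReal (1 + N * ((1 - l) / l)) ^ t) ^ s with hc
    set c' := ENNReal.ofReal (1 + N * ((1 - l') / l')) ^ t with hc'
    have hct : c ≠ ⊤ := ENNReal.pow_ne_top (ENNReal.pow_ne_top ENNReal.ofReal_ne_top)
    have hct' : c' ≠ ⊤ := ENNReal.pow_ne_top ENNReal.ofReal_ne_top
    refine ⟨C + c' * (ENNReal.ofReal (d i * 2 ^ 3) * c), ?_, fun 𝒰 h𝒰 => ?_⟩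
    · exact ENNReal.add_ne_top.2 ⟨hC, ENNReal.mul_ne_top hct'
        (ENNReal.mul_ne_top ENNReal.ofReal_ne_top hct)⟩
    obtain ⟨k, hk, hkr⟩ := hall 𝒰 h𝒰
    set E := ⋃ R ∈ 𝒰, R.box with hE
    have hWm : MeasurableSet (haloSeq l E s) :=
      measurableSet_haloSeq hb l (measurableSet_biUnion_box 𝒰) s
    have hWv : volume (haloSeq l E s) ≤ c * volume E :=
      volume_haloSeq_le hb hl hl1 (measurableSet_biUnion_box 𝒰) s
    have hWt : volume (haloSeq l E s) ≠ ⊤ := ne_top_of_le_ne_top (ENNReal.mul_ne_top hct h𝒰) hWv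
    have hκ : ∀ R, ∃ m : ℕ, R ∈ 𝒰 → _ := fun R =>
      if hR : R ∈ 𝒰 then
        (exists_dilation_exponent hd he0 he1 his hWt (hk R hR)).imp fun _ h _ => h
      else ⟨0, fun h => absurd h hR⟩
    choose κ hκ using hκ
    refine ⟨fun R => Function.update (k R) i (κ R), fun R hR => ?_, fun r hr n => ?_⟩
    · exact pi_expandedSide_subset_mixedHalo hl hl1 (hb (s + 1)) his hWm (hκ R hR).1
    · by_cases hri : r = i
      · subst hri
        refine (tsum_volume_biUnion_box_le (s := s) (k := k) (W := haloSeq l E s) (n := n) (e := e)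
          (fun Q R hR => hR.2.2) (fun Q R hR => hk R hR.1) his (hd _) hWm hl' hl1' (hb s) he0.le
          he1.le hle fun Q R hR => ?_).trans ?_
        · have := (hκ R hR.1).2
          have hn : κ R = n := by simpa using hR.2.1
          rwa [hn] at this
        · have h8 : ENNReal.ofReal (d i * 2 ^ (n + 3)) = ENNReal.ofReal (d i * 2 ^ 3) * 2 ^ n := by
            rw [pow_add, mul_comm ((2 : ℝ) ^ n), ← mul_assoc, ENNReal.ofReal_mul (by positivity),
              ENNReal.ofReal_pow (by norm_num), ENNReal.ofReal_ofNat]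
          calc _ ≤ c' * (ENNReal.ofReal (d i * 2 ^ (n + 3)) * (c * volume E)) := by gcongr
            _ = c' * (ENNReal.ofReal (d i * 2 ^ 3) * c) * 2 ^ n * volume E := by
                rw [h8]
                ring
            _ ≤ _ := by
                gcongr
                exact le_add_self
      · have hne : (r : ℕ) ≠ s := fun h => hri (Fin.ext h)
        simp only [Function.update_of_ne hri]
        refine (hkr r (by lia) n).trans ?_
        gcongr
        exact le_self_add

/-- The coordinates of a point of the model space, grouped by factors. -/
def groupCoords (x : Rd t d) : ProdSpace t d := fun s j => x ⟨s, j⟩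

theorem measurePreserving_piCurry (t : ℕ) (d : Fin t → ℕ) :
    MeasurePreserving (MeasurableEquiv.piCurry fun (s : Fin t) (_ : Fin (d s)) => ℝ)
      volume volume := by
  have h : MeasurePreserving (MeasurableEquiv.piCurry fun (s : Fin t) (_ : Fin (d s)) => ℝ).symm
      volume volume := by
    refine ⟨MeasurableEquiv.measurable _, ?_⟩
    refine (Measure.pi_eq fun S hS => ?_).symm
    rw [MeasurableEquiv.map_apply]
    have : (MeasurableEquiv.piCurry fun (s : Fin t) (_ : Fin (d s)) => ℝ).symm ⁻¹'
        Set.pi Set.univ S =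
        Set.pi Set.univ fun s => Set.pi Set.univ fun j : Fin (d s) => S ⟨s, j⟩ := by
      ext x
      simp [Set.mem_pi, Sigma.forall, MeasurableEquiv.coe_piCurry_symm, Sigma.uncurry]
    rw [this, volume_pi, Measure.pi_pi, Fintype.prod_sigma]
    exact Finset.prod_congr rfl fun s _ => by rw [volume_pi, Measure.pi_pi]
  exact h.symm

theorem measurePreserving_groupCoords :
    MeasurePreserving (groupCoords : Rd t d → ProdSpace t d) volume volume :=
  (measurePreserving_piCurry t d).comp (PiLp.volume_preserving_ofLp _)

theorem toSet_eq_preimage_box (R : DyadicRect t d) : R.toSet = groupCoords ⁻¹' R.box := by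
  ext x
  simp only [DyadicRect.toSet, DyadicRect.box, Set.mem_preimage, Set.mem_pi, Set.mem_univ,
    forall_const, mem_dyadicCube, Set.mem_ofPred_eq]
  rfl

theorem shadow_eq_preimage (𝒰 : Set (DyadicRect t d)) :
    shadow 𝒰 = groupCoords ⁻¹' ⋃ R ∈ 𝒰, R.box := by
  simp only [shadow, toSet_eq_preimage_box, Set.preimage_iUnion]

theorem volume_shadow (𝒰 : Set (DyadicRect t d)) :
    volume (shadow 𝒰) = volume (⋃ R ∈ 𝒰, R.box) := by
  rw [shadow_eq_preimage, measurePreserving_groupCoords.measure_preimage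
    (measurableSet_biUnion_box 𝒰).nullMeasurableSet]

/-- The closed rectangle with the same center as `R` and side lengths multiplied by `2 ^ m`. -/
def DyadicRect.dilatedBox (R : DyadicRect t d) (m : ℕ) : Set (ProdSpace t d) :=
  Set.pi Set.univ fun r => Metric.closedBall (dyadicCenter (R.side r)) (2 ^ (m + R.k r - 1))

theorem dilate_two_pow (R : DyadicRect t d) (m : ℕ) :
    R.dilate (2 ^ m) = groupCoords ⁻¹' R.dilatedBox m := by
  ext x
  simp only [DyadicRect.dilate, DyadicRect.dilatedBox, Set.mem_preimage, Set.mem_pi, Set.mem_univ,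
    forall_const, Set.mem_ofPred_eq, Metric.mem_closedBall]
  refine forall_congr' fun r => ?_
  have h2 : (2 : ℝ) ^ (m + R.k r - 1) = 2 ^ m * 2 ^ R.k r / 2 := by
    rw [zpow_sub₀ (by norm_num), zpow_add₀ (by norm_num), zpow_natCast, zpow_one]
  rw [dist_pi_le_iff (by positivity)]
  refine forall_congr' fun j => ?_
  rw [h2, Real.dist_eq]
  rfl

theorem volume_dilatedBox (R : DyadicRect t d) (m : ℕ) :
    volume (R.dilatedBox m) = ∏ r, ENNReal.ofReal ((2 ^ (m + R.k r)) ^ d r) := by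
  rw [DyadicRect.dilatedBox, volume_pi, Measure.pi_pi]
  simp only [volume_closedBall_two_zpow, sub_add_cancel]

theorem volume_box (R : DyadicRect t d) :
    volume R.box = ∏ r, ENNReal.ofReal ((2 ^ R.k r) ^ d r) := by
  rw [DyadicRect.box, volume_pi, Measure.pi_pi]
  simp only [volume_dyadicCube, DyadicRect.side]

theorem volume_box_ne_zero (R : DyadicRect t d) : volume R.box ≠ 0 := by
  rw [volume_box, Finset.prod_ne_zero_iff]
  intro r _
  simp only [ne_eq, ENNReal.ofReal_eq_zero, not_le]
  positivity

theorem box_subset_dilatedBox (R : DyadicRect t d) : R.box ⊆ R.dilatedBox 0 :=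
  Set.pi_mono fun r _ => by simpa [DyadicRect.side] using dyadicCube_subset_closedBall (R.side r)

theorem measurableSet_box (R : DyadicRect t d) : MeasurableSet R.box :=
  MeasurableSet.univ_pi fun _ => measurableSet_dyadicCube _

theorem measurableSet_dilatedBox (R : DyadicRect t d) (m : ℕ) : MeasurableSet (R.dilatedBox m) :=
  MeasurableSet.univ_pi fun _ => measurableSet_closedBall

theorem volume_dilatedBox_sdiff_box (R : DyadicRect t d) :
    volume (R.dilatedBox 0 \ R.box) = 0 := by
  have h : volume (R.dilatedBox 0) = volume R.box := by
    rw [volume_dilatedBox, volume_box]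
    simp
  have ht : volume R.box ≠ ⊤ := by
    rw [volume_box]
    exact ENNReal.prod_ne_top fun _ _ => ENNReal.ofReal_ne_top
  rw [measure_sdiff (box_subset_dilatedBox R) (measurableSet_box R).nullMeasurableSet ht, h,
    tsub_self]

/-- A set of finite measure which contains the closure of `R` contains a largest dilate of `R` by a
power of two. -/
theorem exists_max_dilatedBox_subset (ht : 0 < t) (hd : ∀ s, 0 < d s) (R : DyadicRect t d)
    {V : Set (ProdSpace t d)} (hV : volume V ≠ ⊤) (hRV : R.dilatedBox 0 ⊆ V) :
    ∃ m, R.dilatedBox m ⊆ V ∧ ∀ j, R.dilatedBox j ⊆ V → j ≤ m := by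
  set i : Fin t := ⟨0, ht⟩
  set p := ∏ r ∈ Finset.univ.erase i, ENNReal.ofReal (((2 : ℝ) ^ R.k r) ^ d r) with hp
  have hp0 : p ≠ 0 := by
    rw [hp, Finset.prod_ne_zero_iff]
    intro r _
    simp only [ne_eq, ENNReal.ofReal_eq_zero, not_le]
    positivity
  have hpt : p ≠ ⊤ := ENNReal.prod_ne_top fun _ _ => ENNReal.ofReal_ne_top
  obtain ⟨B, hB⟩ := exists_scale_bound (hd i) (ENNReal.div_ne_top hV hp0)
  have hbdd : BddAbove {j | R.dilatedBox j ⊆ V} := by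
    refine ⟨(B - R.k i).toNat, fun j hj => ?_⟩
    have := hB (j + R.k i) (by
      rw [ENNReal.le_div_iff_mul_le (Or.inl hp0) (Or.inl hpt)]
      refine le_trans ?_ (measure_mono hj)
      rw [volume_dilatedBox, ← Finset.mul_prod_erase _ _ (Finset.mem_univ i)]
      rw [hp]
      gcongr
      · norm_num
      · lia)
    lia
  exact ⟨sSup {j | R.dilatedBox j ⊆ V}, Nat.sSup_mem ⟨0, hRV⟩ hbdd, fun j hj => le_csSup hbdd hj⟩

theorem dilatedBox_subset_pi_expandedSide {k : Fin t → ℕ} (R : DyadicRect t d) {m : ℕ}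
    (h : ∀ r, m + t ≤ k r) : R.dilatedBox m ⊆ Set.pi Set.univ (R.expandedSide t k) := by
  refine Set.pi_mono fun r _ => ?_
  rw [DyadicRect.expandedSide, if_pos r.2]
  refine Metric.closedBall_subset_closedBall (zpow_le_zpow_right₀ (by norm_num) ?_)
  have := h r
  lia

theorem exists_halo_level (N n : ℕ) {η : ℝ} (hη : 0 < η) :
    ∃ l : ℝ, 0 < l ∧ l < 1 ∧
      (ENNReal.ofReal (1 + N * ((1 - l) / l)) ^ n) ^ n ≤ ENNReal.ofReal (1 + η) := by
  have hc : Filter.Tendsto (fun l : ℝ => ((1 + N * ((1 - l) / l)) ^ n) ^ n)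
      (nhdsWithin 1 (Set.Iio 1)) (nhds 1) := by
    have : ContinuousAt (fun l : ℝ => ((1 + N * ((1 - l) / l)) ^ n) ^ n) 1 := by
      fun_prop (disch := norm_num)
    simpa using this.tendsto.mono_left nhdsWithin_le_nhds
  obtain ⟨l, h1, h2⟩ := ((hc.eventually_lt_const (lt_add_of_pos_right 1 hη)).and
    (Ioo_mem_nhdsLT (zero_lt_one' ℝ))).exists
  refine ⟨l, h2.1, h2.2, ?_⟩
  have h0 : 0 ≤ 1 + N * ((1 - l) / l) := by
    have := div_nonneg (sub_nonneg.2 h2.2.le) h2.1.le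
    positivity
  rw [← ENNReal.ofReal_pow h0, ← ENNReal.ofReal_pow (by positivity)]
  exact ENNReal.ofReal_le_ofReal h1.le

/-- The coefficients of a collection with `t - 1` parameters are controlled by its shadow. -/
theorem tsum_sq_le_of_hasParamsSub (a : DyadicRect t d → ℂ) {𝒮 : Set (DyadicRect t d)}
    (h𝒮 : HasParamsSub 𝒮) (hfin : volume (⋃ R ∈ 𝒮, R.box) ≠ ⊤) :
    ∑' R : 𝒮, (‖a R.1‖₊ : ℝ≥0∞) ^ 2 ≤ carlesonNormM1 a ^ 2 * volume (⋃ R ∈ 𝒮, R.box) := by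
  by_cases h0 : volume (⋃ R ∈ 𝒮, R.box) = 0
  · have : 𝒮 = ∅ := by
      refine Set.eq_empty_of_forall_notMem fun R hR => volume_box_ne_zero R ?_
      exact measure_mono_null (Set.subset_biUnion_of_mem (u := DyadicRect.box) hR) h0
    subst this
    simp
  · have h : ((volume (shadow 𝒮))⁻¹ * ∑' R : 𝒮, (‖a R.1‖₊ : ℝ≥0∞) ^ 2) ^ (1 / 2 : ℝ) ≤
        carlesonNormM1 a :=
      le_iSup₂ (f := fun (𝒰 : Set (DyadicRect t d)) (_ : HasParamsSub 𝒰) =>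
        ((volume (shadow 𝒰))⁻¹ * ∑' R : 𝒰, ((‖a R.1‖₊ : ℝ≥0∞)) ^ 2) ^ (1/2 : ℝ)) 𝒮 h𝒮
    rw [one_div, ENNReal.rpow_inv_le_iff (by norm_num), volume_shadow] at h
    rw [← ENNReal.div_le_iff h0 hfin, ENNReal.div_eq_inv_mul]
    exact_mod_cast h

theorem tsum_weighted_le {k : DyadicRect t d → Fin t → ℕ} {𝒰 : Set (DyadicRect t d)} (i : Fin t)
    {C : ℝ≥0∞} (hfin : volume (⋃ R ∈ 𝒰, R.box) ≠ ⊤)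
    (hC : ∀ n, ∑' Q, volume (⋃ R ∈ {R | R ∈ 𝒰 ∧ k R i = n ∧ R.side i = Q}, R.box) ≤
      C * 2 ^ n * volume (⋃ R ∈ 𝒰, R.box)) (a : DyadicRect t d → ℂ) :
    ∑' R : 𝒰, (4⁻¹ : ℝ≥0∞) ^ k R.1 i * (‖a R.1‖₊ : ℝ≥0∞) ^ 2 ≤
      2 * C * (carlesonNormM1 a ^ 2 * volume (⋃ R ∈ 𝒰, R.box)) := by
  set 𝒮 : ℕ → ℤ × (Fin (d i) → ℤ) → Set (DyadicRect t d) := fun n Q =>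
    {R | R ∈ 𝒰 ∧ k R i = n ∧ R.side i = Q} with h𝒮
  set g : DyadicRect t d → ℝ≥0∞ := fun R => (‖a R‖₊ : ℝ≥0∞) ^ 2 with hg
  set v := volume (⋃ R ∈ 𝒰, R.box) with hv
  calc ∑' R : 𝒰, (4⁻¹ : ℝ≥0∞) ^ k R.1 i * g R.1
      = ∑' R, 𝒰.indicator (fun R => (4⁻¹ : ℝ≥0∞) ^ k R i * g R) R :=
        tsum_subtype 𝒰 fun R => (4⁻¹ : ℝ≥0∞) ^ k R i * g R
    _ ≤ ∑' R, ∑' n, ∑' Q, (𝒮 n Q).indicator (fun R => (4⁻¹ : ℝ≥0∞) ^ n * g R) R := by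
        refine ENNReal.tsum_le_tsum fun R => ?_
        by_cases hR : R ∈ 𝒰
        · refine le_trans ?_ (ENNReal.le_tsum (k R i))
          refine le_trans ?_ (ENNReal.le_tsum (R.side i))
          rw [Set.indicator_of_mem hR, Set.indicator_of_mem (by exact ⟨hR, rfl, rfl⟩)]
        · rw [Set.indicator_of_notMem hR]
          exact zero_le
    _ = ∑' n, ∑' Q, ∑' R, (𝒮 n Q).indicator (fun R => (4⁻¹ : ℝ≥0∞) ^ n * g R) R := by
        rw [ENNReal.tsum_comm]
        exact tsum_congr fun n => ENNReal.tsum_comm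
    _ = ∑' n, ∑' Q, (4⁻¹ : ℝ≥0∞) ^ n * ∑' R : 𝒮 n Q, g R.1 := by
        refine tsum_congr fun n => tsum_congr fun Q => ?_
        rw [← tsum_subtype (𝒮 n Q) fun R => (4⁻¹ : ℝ≥0∞) ^ n * g R, ENNReal.tsum_mul_left]
    _ ≤ ∑' n, ∑' Q, (4⁻¹ : ℝ≥0∞) ^ n *
          (carlesonNormM1 a ^ 2 * volume (⋃ R ∈ 𝒮 n Q, R.box)) := by
        gcongr with n Q
        refine tsum_sq_le_of_hasParamsSub a ⟨i, Q.1, Q.2, fun R hR => ?_⟩ ?_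
        · exact ⟨congrArg Prod.fst hR.2.2, congrArg Prod.snd hR.2.2⟩
        · exact ne_top_of_le_ne_top hfin
            (measure_mono (Set.biUnion_subset_biUnion_left fun R hR => hR.1))
    _ = ∑' n, (4⁻¹ : ℝ≥0∞) ^ n *
          (carlesonNormM1 a ^ 2 * ∑' Q, volume (⋃ R ∈ 𝒮 n Q, R.box)) := by
        simp only [ENNReal.tsum_mul_left]
    _ ≤ ∑' n, (4⁻¹ : ℝ≥0∞) ^ n * (carlesonNormM1 a ^ 2 * (C * 2 ^ n * v)) := by
        gcongr with n
        exact hC n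
    _ = ∑' n, (2⁻¹ : ℝ≥0∞) ^ n * (C * (carlesonNormM1 a ^ 2 * v)) := by
        refine tsum_congr fun n => ?_
        have h42 : (4⁻¹ : ℝ≥0∞) * 2 = 2⁻¹ := by
          rw [show (4 : ℝ≥0∞) = 2 * 2 by norm_num, ENNReal.mul_inv (by simp) (by simp), mul_assoc,
            ENNReal.inv_mul_cancel (by simp) (by simp), mul_one]
        rw [← h42, mul_pow]
        ring
    _ = _ := by
        rw [ENNReal.tsum_mul_right, ENNReal.tsum_geometric, ENNReal.one_sub_inv_two, inv_inv,
          mul_assoc]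

/-- The coefficients of a subcollection, weighted by a dilation exponent which is admissible for the
halo of its shadow, are controlled by the measure of the shadow. -/
theorem tsum_weighted_exponent_le (ht : 0 < t) {l : ℝ} {C : ℝ≥0∞} {𝒰 : Set (DyadicRect t d)}
    (hfin : volume (⋃ R ∈ 𝒰, R.box) ≠ ⊤) {k : DyadicRect t d → Fin t → ℕ}
    (hk : ∀ R ∈ 𝒰, Set.pi Set.univ (R.expandedSide t (k R)) ⊆ haloSeq l (⋃ R ∈ 𝒰, R.box) t)
    (hC : ∀ i : Fin t, ∀ n,
      ∑' Q, volume (⋃ R ∈ {R | R ∈ 𝒰 ∧ k R i = n ∧ R.side i = Q}, R.box) ≤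
        C * 2 ^ n * volume (⋃ R ∈ 𝒰, R.box))
    {m : DyadicRect t d → ℕ}
    (hm : ∀ R ∈ 𝒰, ∀ j, R.dilatedBox j ⊆ haloSeq l (⋃ R ∈ 𝒰, R.box) t → j ≤ m R)
    (a : DyadicRect t d → ℂ) :
    ∑' R : 𝒰, (4⁻¹ : ℝ≥0∞) ^ m R.1 * (‖a R.1‖₊ : ℝ≥0∞) ^ 2 ≤
      4 ^ t * (t * (2 * C * (carlesonNormM1 a ^ 2 * volume (⋃ R ∈ 𝒰, R.box)))) := by
  have hne : Nonempty (Fin t) := ⟨⟨0, ht⟩⟩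
  have hmin : ∀ R ∈ 𝒰, ∃ i, k R i ≤ m R + t := by
    intro R hR
    obtain ⟨i, hi⟩ := Finite.exists_min (k R)
    refine ⟨i, ?_⟩
    by_cases h : k R i ≤ t
    · lia
    · have := hm R hR (k R i - t) ((dilatedBox_subset_pi_expandedSide R fun r => by
        have := hi r
        lia).trans (hk R hR))
      lia
  have h4 : (4 : ℝ≥0∞)⁻¹ ≤ 1 := ENNReal.inv_le_one.2 (by norm_num)
  have hpt : ∀ R : 𝒰, (4⁻¹ : ℝ≥0∞) ^ m R.1 ≤ 4 ^ t * ∑ i, (4⁻¹ : ℝ≥0∞) ^ k R.1 i := by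
    rintro ⟨R, hR⟩
    obtain ⟨i, hi⟩ := hmin R hR
    calc (4⁻¹ : ℝ≥0∞) ^ m R = 4 ^ t * (4⁻¹ : ℝ≥0∞) ^ (m R + t) := by
          rw [pow_add, mul_left_comm, ← mul_pow, ENNReal.mul_inv_cancel (by simp) (by simp),
            one_pow, mul_one]
      _ ≤ 4 ^ t * (4⁻¹ : ℝ≥0∞) ^ k R i := by
          gcongr 4 ^ t * ?_
          exact pow_le_pow_of_le_one zero_le h4 hi
      _ ≤ _ := by
          gcongr
          exact Finset.single_le_sum (f := fun i => (4⁻¹ : ℝ≥0∞) ^ k R i)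
            (fun _ _ => zero_le) (Finset.mem_univ i)
  calc _ ≤ ∑' R : 𝒰, 4 ^ t * ∑ i, (4⁻¹ : ℝ≥0∞) ^ k R.1 i * (‖a R.1‖₊ : ℝ≥0∞) ^ 2 := by
        refine ENNReal.tsum_le_tsum fun R => ?_
        rw [← Finset.sum_mul, ← mul_assoc]
        gcongr
        exact hpt R
    _ = 4 ^ t * ∑ i, ∑' R : 𝒰, (4⁻¹ : ℝ≥0∞) ^ k R.1 i * (‖a R.1‖₊ : ℝ≥0∞) ^ 2 := by
        rw [ENNReal.tsum_mul_left, Summable.tsum_finsetSum fun _ _ => ENNReal.summable]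
    _ ≤ 4 ^ t * ∑ _i : Fin t,
          2 * C * (carlesonNormM1 a ^ 2 * volume (⋃ R ∈ 𝒰, R.box)) := by
        gcongr with i
        exact tsum_weighted_le i hfin (hC i) a
    _ = _ := by
        rw [Finset.sum_const, Finset.card_univ, Fintype.card_fin, nsmul_eq_mul]

theorem rpow_half_le_of_tsum_le {v S B A : ℝ≥0∞} (hv0 : v ≠ 0) (hvt : v ≠ ⊤)
    (h : S ≤ B ^ 2 * (A ^ 2 * v)) : (v⁻¹ * S) ^ (1 / 2 : ℝ) ≤ B * A := by
  rw [one_div, ENNReal.rpow_inv_le_iff (by norm_num), ← ENNReal.div_eq_inv_mul,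
    ENNReal.div_le_iff hv0 hvt, ENNReal.rpow_two, mul_pow, mul_assoc]
  exact h

theorem coe_nnnorm_two_pow_rpow_neg_one_sq (m : ℕ) :
    (4⁻¹ : ℝ≥0∞) ^ m = (‖(((2 ^ m : ℝ) ^ (-1 : ℝ) : ℝ) : ℂ)‖₊ : ℝ≥0∞) ^ 2 := by
  rw [Real.rpow_neg_one, ← enorm_eq_nnnorm, ← ofReal_norm, Complex.norm_real,
    Real.norm_of_nonneg (by positivity), ENNReal.ofReal_inv_of_pos (by positivity),
    ENNReal.ofReal_pow (by norm_num), ENNReal.ofReal_ofNat, ← ENNReal.inv_pow,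
    ← ENNReal.inv_pow, ← pow_mul, mul_comm m, pow_mul]
  norm_num

/-- **Journé's Lemma** (Lemma 3.4, coefficient form, with the refinement
`|V| ≤ (1+η)|sh(𝒰)|`). -/
theorem journe_lemma (t : ℕ) (ht : 2 ≤ t) (d : Fin t → ℕ) (hd : ∀ s, 0 < d s) :
    ∃ C : ℝ, 0 < C ∧
      ∀ η : ℝ, 0 < η →
        ∃ K : ℝ, 0 < K ∧
          ∀ 𝒰 : Set (DyadicRect t d), volume (shadow 𝒰) < ⊤ →
            ∃ (V : Set (Rd t d)) (Emb : {R : DyadicRect t d // R ∈ 𝒰} → ℝ),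
              MeasurableSet V ∧ shadow 𝒰 ⊆ V ∧
              (∀ R : {R : DyadicRect t d // R ∈ 𝒰}, 1 ≤ Emb R) ∧
              (∀ R : {R : DyadicRect t d // R ∈ 𝒰},
                DyadicRect.dilate R.1 (Emb R) ⊆ V) ∧
              volume V ≤ ENNReal.ofReal (1 + η) * volume (shadow 𝒰) ∧
              (∀ a : DyadicRect t d → ℂ,
                carlesonNorm (fun R =>
                    if h : R ∈ 𝒰 then ((Emb ⟨R, h⟩ ^ (-C) : ℝ) : ℂ) * a R else 0)
                  ≤ ENNReal.ofReal K * carlesonNormM1 a) := by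
  have ht0 : 0 < t := by lia
  obtain ⟨N, hb⟩ := exists_isHaloBasis_mixedBasis hd
  refine ⟨1, one_pos, fun η hη => ?_⟩
  obtain ⟨l, hl, hl1, hlη⟩ := exists_halo_level N t hη
  obtain ⟨C, hC, hdil⟩ := exists_dilation_exponents hd hb hl hl1 t le_rfl
  set B : ℝ≥0∞ := 4 ^ t * (t * (2 * C)) with hB
  have hBt : B ≠ ⊤ := by
    refine ENNReal.mul_ne_top (ENNReal.pow_ne_top (by simp)) (ENNReal.mul_ne_top (by simp) ?_)
    exact ENNReal.mul_ne_top (by simp) hC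
  have hB1 : 0 < B.toReal + 1 := by positivity
  have hBsq : B ≤ ENNReal.ofReal (B.toReal + 1) ^ 2 := by
    rw [← ENNReal.ofReal_pow hB1.le, ← ENNReal.ofReal_toReal hBt, ENNReal.toReal_ofReal (by simp)]
    refine ENNReal.ofReal_le_ofReal ?_
    nlinarith [B.toReal_nonneg]
  refine ⟨B.toReal + 1, hB1, fun 𝒰 h𝒰 => ?_⟩
  rw [volume_shadow] at h𝒰
  set E := ⋃ R ∈ 𝒰, R.box with hE
  have hEm : MeasurableSet E := measurableSet_biUnion_box 𝒰
  set H := haloSeq l E t with hH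
  have hHm : MeasurableSet H := measurableSet_haloSeq hb l hEm t
  set V := H ∪ ⋃ R ∈ 𝒰, R.dilatedBox 0 with hV
  have hVm : MeasurableSet V :=
    hHm.union (MeasurableSet.biUnion (Set.to_countable _) fun R _ => measurableSet_dilatedBox R 0)
  have hVv : volume V ≤ ENNReal.ofReal (1 + η) * volume E := by
    have hnull : volume (⋃ R ∈ 𝒰, R.dilatedBox 0 \ R.box) = 0 :=
      (measure_biUnion_null_iff (Set.to_countable _)).2 fun R _ => volume_dilatedBox_sdiff_box R
    have hsub : V ⊆ H ∪ ⋃ R ∈ 𝒰, R.dilatedBox 0 \ R.box := by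
      refine Set.union_subset Set.subset_union_left (Set.iUnion₂_subset fun R hR x hx => ?_)
      by_cases hxR : x ∈ R.box
      · exact Or.inl (subset_haloSeq l E t (Set.mem_biUnion hR hxR))
      · exact Or.inr (Set.mem_biUnion hR ⟨hx, hxR⟩)
    calc volume V ≤ volume H + 0 := hnull ▸ (measure_mono hsub).trans (measure_union_le _ _)
      _ ≤ _ := by
          rw [add_zero]
          refine (volume_haloSeq_le hb hl hl1 hEm t).trans ?_
          gcongr
  have hVt : volume V ≠ ⊤ :=
    ne_top_of_le_ne_top (ENNReal.mul_ne_top ENNReal.ofReal_ne_top h𝒰.ne) hVv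
  have hex : ∀ R, ∃ m : ℕ, R ∈ 𝒰 → R.dilatedBox m ⊆ V ∧ ∀ j, R.dilatedBox j ⊆ V → j ≤ m := fun R =>
    if hR : R ∈ 𝒰 then
      (exists_max_dilatedBox_subset ht0 hd R hVt
        ((Set.subset_biUnion_of_mem (u := fun R : DyadicRect t d => R.dilatedBox 0) hR).trans
          Set.subset_union_right)).imp fun _ h _ => h
    else ⟨0, fun h => absurd h hR⟩
  choose m hm using hex
  refine ⟨groupCoords ⁻¹' V, fun R => 2 ^ m R.1,
    measurePreserving_groupCoords.measurable hVm, ?_, fun R => one_le_pow₀ (by norm_num),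
    fun R => ?_, ?_, fun a => ?_⟩
  · rw [shadow_eq_preimage]
    exact Set.preimage_mono ((subset_haloSeq l E t).trans Set.subset_union_left)
  · rw [dilate_two_pow]
    exact Set.preimage_mono (hm R.1 R.2).1
  · rwa [volume_shadow, measurePreserving_groupCoords.measure_preimage hVm.nullMeasurableSet]
  · refine iSup₂_le fun U ⟨_, hU0, hUt⟩ => ?_
    refine rpow_half_le_of_tsum_le hU0.ne' hUt.ne ?_
    set 𝒮 : Set (DyadicRect t d) := {R | R ∈ 𝒰 ∧ R.toSet ⊆ U} with h𝒮
    set F := ⋃ R ∈ 𝒮, R.box with hF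
    have hFE : F ⊆ E := Set.biUnion_subset_biUnion_left fun R hR => hR.1
    have hFU : volume F ≤ volume U := by
      rw [hF, ← volume_shadow]
      exact measure_mono (Set.iUnion₂_subset fun R hR => hR.2)
    have hFt : volume F ≠ ⊤ := ne_top_of_le_ne_top hUt.ne hFU
    obtain ⟨k, hk, hkC⟩ := hdil 𝒮 hFt
    have hsum := tsum_weighted_exponent_le ht0 hFt hk (fun i n => hkC i i.2 n) (m := m)
      (fun R hR j hj => (hm R hR.1).2 j
        (hj.trans ((haloSeq_mono l hFE t).trans Set.subset_union_left))) a
    calc _ = ∑' R : 𝒮, (4⁻¹ : ℝ≥0∞) ^ m R.1 * (‖a R.1‖₊ : ℝ≥0∞) ^ 2 := by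
          rw [tsum_subtype 𝒮 fun R => (4⁻¹ : ℝ≥0∞) ^ m R * (‖a R‖₊ : ℝ≥0∞) ^ 2]
          refine (tsum_subtype {R : DyadicRect t d | R.toSet ⊆ U} fun R => ((‖(if _ : R ∈ 𝒰 then
            ((((2 : ℝ) ^ m R) ^ (-1 : ℝ) : ℝ) : ℂ) * a R else 0 : ℂ)‖₊ : ℝ≥0∞)) ^ 2).trans ?_
          refine tsum_congr fun R => ?_
          by_cases hRU : R.toSet ⊆ U
          · rw [Set.indicator_of_mem (by exact hRU)]
            by_cases hR : R ∈ 𝒰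
            · rw [dif_pos hR, Set.indicator_of_mem (by exact ⟨hR, hRU⟩), nnnorm_mul,
                ENNReal.coe_mul, mul_pow, ← coe_nnnorm_two_pow_rpow_neg_one_sq]
            · rw [dif_neg hR, Set.indicator_of_notMem fun h => hR h.1]
              simp
          · rw [Set.indicator_of_notMem (by exact hRU),
              Set.indicator_of_notMem fun h => hRU h.2]
      _ ≤ 4 ^ t * (t * (2 * C * (carlesonNormM1 a ^ 2 * volume F))) := hsum
      _ = B * (carlesonNormM1 a ^ 2 * volume F) := by
          rw [hB]
          ring
      _ ≤ _ := by gcongr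
end
end
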